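/- Let β ∈ 𝕋 with β ≠ 0 and let f : 𝕋 → ℝ be the centered indicator f(x) = 𝟙_{[0,β)}(x) − ι(β). Then for Haar-almost every α ∈ 𝕋 and for every x₀ ∈ 𝕋, the Birkhoff sums S_N(f,α,x₀) do not satisfy a temporal distributional limit theorem: there do not exist a real sequence (A_M), a positive sequence (B_M) with B_M → ∞, and a non-constant real random variable Y such that for every a ∈ ℝ, (1/M)·#{1 ≤ N ≤ M : (S_N(f,α,x₀) − A_M)/B_M ≤ a} → P[Y ≤ a] as M → ∞. -/

import Mathlib

open MeasureTheory Filter Set Topology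

noncomputable def toCircle (x : ℝ) : UnitAddCircle := x

/-- The canonical embedding `ι : 𝕋 → [0,1) ⊆ ℝ`. -/
noncomputable def iota (x : UnitAddCircle) : ℝ := (AddCircle.equivIco 1 0 x : ℝ)

/-- The Birkhoff sum `S_N(f, α, x₀) = ∑_{k=0}^{N-1} f(x₀ + kα)`. -/
noncomputable def birkhoff (f : UnitAddCircle → ℝ) (α x₀ : UnitAddCircle) (N : ℕ) : ℝ :=
  ∑ k ∈ Finset.range N, f (x₀ + k • α)

open scoped Classical in
/-- `S_N(f, α, x₀)` satisfies a temporal distributional limit theorem: there are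
centering constants `A M`, scaling constants `B M > 0` with `B M → ∞`, and a
non-(a.s.-)constant real random variable `Y` such that, with `N` uniform on
`{1, …, M}`, `(S_N - A_M)/B_M` converges in distribution to `Y` as `M → ∞`. -/
def SatisfiesTDLT (f : UnitAddCircle → ℝ) (α x₀ : UnitAddCircle) : Prop :=
  ∃ (A B : ℕ → ℝ) (Ω : Type) (_ : MeasurableSpace Ω) (P : Measure Ω) (Y : Ω → ℝ),
    (∀ M, 0 < B M) ∧ Filter.Tendsto B Filter.atTop Filter.atTop ∧
    IsProbabilityMeasure P ∧ Measurable Y ∧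
    (¬ ∃ c : ℝ, ∀ᵐ ω ∂P, Y ω = c) ∧
    ∀ a : ℝ, Filter.Tendsto
      (fun M : ℕ => (((Finset.Icc 1 M).filter
        (fun N => (birkhoff f α x₀ N - A M) / B M ≤ a)).card : ℝ) / M)
      Filter.atTop (nhds (P {ω | Y ω ≤ a}).toReal)

namespace NoTDLT

/-- The distance of a residue class modulo `q` to zero. -/
def resDist {q : ℕ} (y : ZMod q) : ℕ := y.valMinAbs.natAbs

/-- A resonance sum controlling the variance of the Birkhoff sums of an interval over the
rotation by `p / q`. -/
noncomputable def resonance (q : ℕ) [NeZero q] (p : ZMod q) : ℝ :=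
  ∑ h : ZMod q, (q : ℝ) ^ 2 / ((resDist h : ℝ) ^ 2 * (resDist (h * p) : ℝ) ^ 2)

lemma resDist_eq_zero {q : ℕ} (y : ZMod q) : resDist y = 0 ↔ y = 0 := by
  simp [resDist]

lemma norm_stdAddChar_sub_one {q : ℕ} [NeZero q] (y : ZMod q) :
    4 * (resDist y : ℝ) / q ≤ ‖ZMod.stdAddChar y - 1‖ := by
  have hq : (0 : ℝ) < q := by exact_mod_cast Nat.pos_of_ne_zero (NeZero.ne q)
  have h1 : ZMod.stdAddChar y = Complex.exp (Complex.I * ((2 * Real.pi * y.valMinAbs / q : ℝ) : ℂ)) := by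
    conv_lhs => rw [← ZMod.coe_valMinAbs y]
    rw [ZMod.stdAddChar_coe]
    congr 1
    push_cast
    ring
  rw [h1, Complex.norm_exp_I_mul_ofReal_sub_one]
  have h2 : 2 * (resDist y : ℝ) ≤ q := by
    have := ZMod.natAbs_valMinAbs_le y
    have : 2 * resDist y ≤ q := by unfold resDist; omega
    exact_mod_cast this
  have h3 : (resDist y : ℝ) = |(y.valMinAbs : ℝ)| := by
    simp [resDist, Nat.cast_natAbs]
  have hpi := Real.pi_pos
  have h4 := Real.mul_abs_le_abs_sin (x := 2 * Real.pi * y.valMinAbs / q / 2) (by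
    rw [show 2 * Real.pi * y.valMinAbs / q / 2 = Real.pi / q * y.valMinAbs by ring, abs_mul, ← h3,
      abs_of_pos (by positivity), div_mul_eq_mul_div, div_le_div_iff₀ hq two_pos]
    nlinarith)
  rw [show 2 * Real.pi * y.valMinAbs / q / 2 = Real.pi / q * y.valMinAbs by ring, abs_mul, ← h3,
      abs_of_pos (by positivity)] at h4
  rw [norm_mul, Real.norm_eq_abs, Real.norm_eq_abs, abs_two,
    show 2 * Real.pi * y.valMinAbs / q / 2 = Real.pi / q * y.valMinAbs by ring]
  have h5 : 2 / Real.pi * (Real.pi / q * (resDist y : ℝ)) = 2 * resDist y / q := by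
    field_simp
  rw [h5] at h4
  calc 4 * (resDist y : ℝ) / q = 2 * (2 * resDist y / q) := by ring
    _ ≤ _ := by gcongr

lemma sum_norm_dft_sq {q : ℕ} [NeZero q] (u : ZMod q → ℂ) :
    ∑ k, ‖ZMod.dft u k‖ ^ 2 = q * ∑ n, ‖u n‖ ^ 2 := by
  have key : ∑ k, (ZMod.dft u k) * (starRingEnd ℂ) (ZMod.dft u k)
      = q * ∑ n, u n * (starRingEnd ℂ) (u n) := by
    simp only [ZMod.dft_apply, map_sum, Finset.sum_mul_sum, smul_eq_mul, map_mul,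
      ← AddChar.map_neg_eq_conj]
    calc _ = ∑ i, ∑ j, ∑ k, (u i * (starRingEnd ℂ) (u j)) * ZMod.stdAddChar (k * (j - i)) := by
          rw [Finset.sum_comm]
          refine Finset.sum_congr rfl fun i _ => ?_
          rw [Finset.sum_comm]
          refine Finset.sum_congr rfl fun j _ => Finset.sum_congr rfl fun k _ => ?_
          rw [show k * (j - i) = -(i * k) + -(-(j * k)) by ring, AddChar.map_add_eq_mul]
          ring
      _ = _ := by
          rw [Finset.mul_sum]
          refine Finset.sum_congr rfl fun i _ => ?_
          simp_rw [← Finset.mul_sum, AddChar.sum_mulShift _ (ZMod.isPrimitive_stdAddChar q),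
            sub_eq_zero, ZMod.card]
          simp
          ring
  simp only [Complex.mul_conj, Complex.normSq_eq_norm_sq] at key
  exact_mod_cast key

lemma dft_shift {q : ℕ} [NeZero q] (u : ZMod q → ℂ) (s k : ZMod q) :
    ZMod.dft (fun n => u (n + s)) k = ZMod.stdAddChar (s * k) * ZMod.dft u k := by
  simp only [ZMod.dft_apply, smul_eq_mul, Finset.mul_sum]
  rw [← Equiv.sum_comp (Equiv.addRight s)
    (fun j => ZMod.stdAddChar (s * k) * (ZMod.stdAddChar (-(j * k)) * u j))]
  refine Finset.sum_congr rfl fun n _ => ?_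
  rw [← mul_assoc, ← AddChar.map_add_eq_mul]
  simp only [Equiv.coe_addRight]
  congr 2
  ring

lemma norm_stdAddChar {q : ℕ} [NeZero q] (y : ZMod q) : ‖ZMod.stdAddChar y‖ = 1 := by
  rw [ZMod.stdAddChar_apply]
  exact Circle.norm_coe _

lemma exists_sum_sub_sq_le {q : ℕ} [NeZero q] {p p' : ZMod q} (hp : p * p' = 1)
    (u g : ZMod q → ℝ) (A B : ZMod q) (hu : ∀ n, u (n + 1) - u n = g n)
    (hg : ∀ n, g (n + p') - g n = (if n = A then 1 else 0) - (if n = B then 1 else 0)) :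
    ∃ c : ℝ, ∑ n, (u n - c) ^ 2 ≤ q * resonance q p := by
  have hq : (0 : ℝ) < q := by exact_mod_cast Nat.pos_of_ne_zero (NeZero.ne q)
  refine ⟨(∑ n, u n) / q, ?_⟩
  set c := (∑ n, u n) / q with hc
  let v : ZMod q → ℂ := fun n => ((u n - c : ℝ) : ℂ)
  have hv0 : ZMod.dft v 0 = 0 := by
    rw [ZMod.dft_apply_zero]
    simp only [v]
    rw [← Complex.ofReal_sum, Finset.sum_sub_distrib]
    simp [ZMod.card, hc, mul_div_cancel₀ _ hq.ne']
  have hgd : ∀ k, ZMod.dft (fun n => (g n : ℂ)) k = (ZMod.stdAddChar k - 1) * ZMod.dft v k := by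
    intro k
    have : (fun n => (g n : ℂ)) = (fun n => v (n + 1)) - v := by
      funext n
      simp [v, ← hu]
    rw [this, map_sub, Pi.sub_apply, dft_shift]
    ring_nf
  have hdd : ∀ k, ‖(ZMod.stdAddChar (p' * k) - 1) * ((ZMod.stdAddChar k - 1) * ZMod.dft v k)‖ ≤ 2 := by
    intro k
    rw [← hgd]
    have : (ZMod.stdAddChar (p' * k) - 1) * ZMod.dft (fun n => (g n : ℂ)) k
        = ZMod.dft (fun n => (if n = A then (1 : ℂ) else 0) - (if n = B then 1 else 0)) k := by
      have h : (fun n => (if n = A then (1 : ℂ) else 0) - (if n = B then 1 else 0))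
          = (fun n => (g (n + p') : ℂ)) - fun n => (g n : ℂ) := by
        funext n
        have := hg n
        rw [Pi.sub_apply, ← Complex.ofReal_sub, this]
        split_ifs <;> simp
      rw [h, map_sub, Pi.sub_apply, dft_shift (fun n => (g n : ℂ))]
      ring
    rw [this, ZMod.dft_apply]
    simp only [smul_eq_mul, mul_sub, Finset.sum_sub_distrib, mul_ite, mul_one, mul_zero,
      Finset.sum_ite_eq', Finset.mem_univ, if_true]
    refine (norm_sub_le _ _).trans ?_
    rw [norm_stdAddChar, norm_stdAddChar]
    norm_num
  have hmain : (q : ℝ) * ∑ n, (u n - c) ^ 2 = ∑ k, ‖ZMod.dft v k‖ ^ 2 := by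
    rw [sum_norm_dft_sq]
    simp only [v, Complex.norm_real, Real.norm_eq_abs, sq_abs]
  have hbd : ∀ h : ZMod q, ‖ZMod.dft v (h * p)‖ ^ 2
      ≤ (q : ℝ) ^ 2 * ((q : ℝ) ^ 2 / ((resDist h : ℝ) ^ 2 * (resDist (h * p) : ℝ) ^ 2)) := by
    intro h
    by_cases hh : h = 0
    · subst hh
      rw [zero_mul, hv0, norm_zero, zero_pow two_ne_zero]
      positivity
    · have hp0 : h * p ≠ 0 := by
        intro h0
        apply hh
        have : h * (p * p') = 0 := by rw [← mul_assoc, h0, zero_mul]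
        rwa [hp, mul_one] at this
      have h1 : (0 : ℝ) < resDist h := by
        exact_mod_cast Nat.pos_of_ne_zero (fun h0 => hh ((resDist_eq_zero h).1 h0))
      have h2 : (0 : ℝ) < resDist (h * p) := by
        exact_mod_cast Nat.pos_of_ne_zero (fun h0 => hp0 ((resDist_eq_zero _).1 h0))
      have h3 := hdd (h * p)
      rw [show p' * (h * p) = h by rw [mul_left_comm, mul_comm p', hp, mul_one], norm_mul,
        norm_mul] at h3
      have h4 := norm_stdAddChar_sub_one h
      have h5 := norm_stdAddChar_sub_one (h * p)
      have h6 : (4 * (resDist h : ℝ) / q) * ((4 * (resDist (h * p) : ℝ) / q) *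
          ‖ZMod.dft v (h * p)‖) ≤ 2 := le_trans (by gcongr) h3
      have h7 : ‖ZMod.dft v (h * p)‖ ≤ (q : ℝ) ^ 2 / (resDist h * resDist (h * p)) := by
        rw [le_div_iff₀ (by positivity)]
        have h8 : (4 * (resDist h : ℝ) / q) * ((4 * (resDist (h * p) : ℝ) / q) *
          ‖ZMod.dft v (h * p)‖) = 16 * (‖ZMod.dft v (h * p)‖ * (resDist h * resDist (h * p))) / q ^ 2 := by
          ring
        rw [h8, div_le_iff₀ (by positivity)] at h6
        nlinarith [norm_nonneg (ZMod.dft v (h * p))]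
      calc ‖ZMod.dft v (h * p)‖ ^ 2 ≤ ((q : ℝ) ^ 2 / (resDist h * resDist (h * p))) ^ 2 := by gcongr
        _ = _ := by rw [div_pow, mul_pow]; ring
  have hsum : ∑ k, ‖ZMod.dft v k‖ ^ 2 ≤ (q : ℝ) ^ 2 * resonance q p := by
    let e : ZMod q ≃ ZMod q :=
      ⟨fun h => h * p, fun h => h * p', fun h => by simp only [mul_assoc, hp, mul_one],
        fun h => by simp only [mul_assoc, mul_comm p' p, hp, mul_one]⟩
    rw [← Equiv.sum_comp e, resonance, Finset.mul_sum]
    exact Finset.sum_le_sum fun h _ => hbd h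
  rw [← hmain] at hsum
  nlinarith

lemma sum_min_one_sq_div_sq_le {x : ℝ} (hx : 0 < x) (n : ℕ) :
    ∑ i ∈ Finset.Icc 1 n, min 1 (x ^ 2 / (i : ℝ) ^ 2) ≤ 4 * x := by
  have h : ∀ n : ℕ, ∑ i ∈ Finset.Icc 1 n, min 1 (x ^ 2 / (i : ℝ) ^ 2) ≤ 4 * (x * n / (x + n)) := by
    intro n
    induction n with
    | zero => simp
    | succ n ih =>
      rw [Finset.sum_Icc_succ_top (by omega)]
      have hn : (0 : ℝ) ≤ n := n.cast_nonneg
      have key : min 1 (x ^ 2 / ((n + 1 : ℕ) : ℝ) ^ 2)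
          ≤ 4 * (x ^ 2 / ((x + n) * (x + (n + 1)))) := by
        push_cast
        rcases le_total x (n + 1) with hxn | hxn
        · refine (min_le_right _ _).trans ?_
          rw [← mul_div_assoc, div_le_div_iff₀ (by positivity) (by positivity)]
          have : (x + n) * (x + (n + 1)) ≤ 4 * (n + 1) ^ 2 := by nlinarith
          nlinarith [sq_nonneg x]
        · refine (min_le_left _ _).trans ?_
          rw [← mul_div_assoc, le_div_iff₀ (by positivity)]
          nlinarith
      have h2 : x * ((n + 1 : ℕ) : ℝ) / (x + ((n + 1 : ℕ) : ℝ))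
          = x * n / (x + n) + x ^ 2 / ((x + n) * (x + (n + 1))) := by
        push_cast
        field_simp
        ring
      rw [h2]
      linarith
  refine (h n).trans ?_
  have : x * n / (x + n) ≤ x := by
    rw [div_le_iff₀ (by positivity)]
    nlinarith
  linarith

lemma card_resDist_eq_le {q : ℕ} [NeZero q] (j : ℕ) :
    (Finset.univ.filter fun y : ZMod q => resDist y = j).card ≤ 2 := by
  have : (Finset.univ.filter fun y : ZMod q => resDist y = j).card
      ≤ ({(j : ℤ), -(j : ℤ)} : Finset ℤ).card := by
    refine Finset.card_le_card_of_injOn (fun y => y.valMinAbs) ?_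
      (ZMod.injective_valMinAbs.injOn)
    intro y hy
    replace hy := (Finset.mem_filter.1 hy).2
    unfold resDist at hy
    simp only [Finset.coe_insert, Finset.coe_singleton, Set.mem_insert_iff, Set.mem_singleton_iff]
    omega
  exact this.trans Finset.card_le_two

lemma sum_resDist_le {q : ℕ} [NeZero q] (φ : ℕ → ℝ) (hφ : ∀ i, 0 ≤ φ i) :
    ∑ y : ZMod q, (if y = 0 then 0 else φ (resDist y)) ≤ 2 * ∑ i ∈ Finset.Icc 1 q, φ i := by
  have h1 : ∑ y : ZMod q, (if y = 0 then 0 else φ (resDist y))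
      = ∑ y ∈ Finset.univ.filter (fun y : ZMod q => y ≠ 0), φ (resDist y) := by
    rw [Finset.sum_filter]
    refine Finset.sum_congr rfl fun y _ => ?_
    by_cases h : y = 0 <;> simp [h]
  have hmaps : ∀ y ∈ Finset.univ.filter (fun y : ZMod q => y ≠ 0), resDist y ∈ Finset.Icc 1 q := by
    intro y hy
    simp only [Finset.mem_filter, Finset.mem_univ, true_and] at hy
    rw [Finset.mem_Icc]
    have h0 := (resDist_eq_zero y).not.2 hy
    have := ZMod.natAbs_valMinAbs_le y
    unfold resDist at *
    omega
  rw [h1, ← Finset.sum_fiberwise_of_maps_to hmaps, Finset.mul_sum]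
  refine Finset.sum_le_sum fun i _ => ?_
  calc _ = ∑ y ∈ (Finset.univ.filter (fun y : ZMod q => y ≠ 0)).filter (fun y => resDist y = i), φ i :=
        Finset.sum_congr rfl fun y hy => by rw [(Finset.mem_filter.1 hy).2]
    _ = (((Finset.univ.filter (fun y : ZMod q => y ≠ 0)).filter (fun y => resDist y = i)).card : ℝ)
          * φ i := by rw [Finset.sum_const, nsmul_eq_mul]
    _ ≤ 2 * φ i := by
        refine mul_le_mul_of_nonneg_right ?_ (hφ i)
        have : ((Finset.univ.filter (fun y : ZMod q => y ≠ 0)).filter (fun y => resDist y = i)).card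
            ≤ 2 := (Finset.card_le_card (by
              intro y hy
              simp only [Finset.mem_filter, Finset.mem_univ, true_and] at hy ⊢
              exact hy.2)).trans (card_resDist_eq_le (q := q) i)
        exact_mod_cast this

lemma card_mul_eq_le {q : ℕ} [NeZero q] (h y : ZMod q) :
    (Finset.univ.filter fun p : ZMod q => h * p = y).card ≤ Nat.gcd h.val q := by
  rcases (Finset.univ.filter fun p : ZMod q => h * p = y).eq_empty_or_nonempty with he | ⟨p₀, hp₀⟩
  · simp [he]
  · have hd : 0 < Nat.gcd h.val q := Nat.gcd_pos_of_pos_right _ (Nat.pos_of_ne_zero (NeZero.ne q))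
    have h1 := IsAddCyclic.card_nsmul_eq_zero_le (α := ZMod q) hd
    refine le_trans ?_ h1
    refine Finset.card_le_card_of_injOn (fun p => p - p₀) ?_ (by
      intro a _ b _ hab
      simpa using hab)
    intro p hp
    replace hp := (Finset.mem_filter.1 hp).2
    replace hp₀ := (Finset.mem_filter.1 hp₀).2
    refine Finset.mem_coe.2 (Finset.mem_filter.2 ⟨Finset.mem_univ _, ?_⟩)
    have h2 : h * (p - p₀) = 0 := by rw [mul_sub, hp, hp₀, sub_self]
    have h3 : ((Nat.gcd h.val q : ℕ) : ZMod q) = h * ((Nat.gcdA h.val q : ℤ) : ZMod q) := by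
      have := congrArg (fun z : ℤ => (z : ZMod q)) (Nat.gcd_eq_gcd_ab h.val q)
      simpa using this
    rw [nsmul_eq_mul, h3, mul_right_comm, h2, zero_mul]

lemma gcd_dvd_resDist_mul {q : ℕ} [NeZero q] (h p : ZMod q) :
    Nat.gcd h.val q ∣ resDist (h * p) := by
  have h1 : ((Nat.gcd h.val q : ℕ) : ℤ) ∣ (h * p).valMinAbs := by
    have h2 : (((h * p).valMinAbs : ℤ) : ZMod q) = ((h.val * p.val : ℤ) : ZMod q) := by
      rw [ZMod.coe_valMinAbs]; simp
    have h3 := (ZMod.intCast_eq_intCast_iff_dvd_sub _ _ _).1 h2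
    have h4 : ((Nat.gcd h.val q : ℕ) : ℤ) ∣ (h.val * p.val : ℤ) - (h * p).valMinAbs :=
      dvd_trans (Int.natCast_dvd_natCast.2 (Nat.gcd_dvd_right _ _)) h3
    have h5 : ((Nat.gcd h.val q : ℕ) : ℤ) ∣ (h.val * p.val : ℤ) :=
      dvd_mul_of_dvd_left (Int.natCast_dvd_natCast.2 (Nat.gcd_dvd_left _ _)) _
    simpa using dvd_sub h5 h4
  exact Int.natCast_dvd.1 h1

lemma sum_min_resDist_mul_le {q : ℕ} [NeZero q] (h : ZMod q) {X : ℝ} (hX : 0 < X) :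
    ∑ p : ZMod q, (if h * p = 0 then 0 else min 1 (X ^ 2 / (resDist (h * p) : ℝ) ^ 2)) ≤ 8 * X := by
  set d := Nat.gcd h.val q with hd
  have hd0 : 0 < d := Nat.gcd_pos_of_pos_right _ (Nat.pos_of_ne_zero (NeZero.ne q))
  have hd0' : (0 : ℝ) < d := by exact_mod_cast hd0
  let φ : ℕ → ℝ := fun j => if d ∣ j then min 1 (X ^ 2 / (j : ℝ) ^ 2) else 0
  have hφ : ∀ i, 0 ≤ φ i := fun i => by
    simp only [φ]; split_ifs <;> positivity
  have h1 : ∀ p : ZMod q, (if h * p = 0 then 0 else min 1 (X ^ 2 / (resDist (h * p) : ℝ) ^ 2))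
      = (fun y => if y = 0 then 0 else φ (resDist y)) (h * p) := by
    intro p
    simp only [φ, hd, gcd_dvd_resDist_mul h p, if_true]
  have h2 : ∑ j ∈ Finset.Icc 1 q, φ j ≤ 4 * (X / d) := by
    refine le_trans ?_ (sum_min_one_sq_div_sq_le (div_pos hX hd0') q)
    have h3 : ∑ j ∈ Finset.Icc 1 q, φ j
        = ∑ j ∈ (Finset.Icc 1 q).filter (fun j => d ∣ j), min 1 (X ^ 2 / (j : ℝ) ^ 2) := by
      rw [Finset.sum_filter]
    have h4 : ∀ i ∈ Finset.Icc 1 q, min 1 ((X / d) ^ 2 / (i : ℝ) ^ 2)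
        = (fun j : ℕ => min 1 (X ^ 2 / (j : ℝ) ^ 2)) (d * i) := by
      intro i _
      simp only [Nat.cast_mul, div_pow, mul_pow, div_div]
    rw [h3, Finset.sum_congr rfl h4,
      ← Finset.sum_image (f := fun j : ℕ => min 1 (X ^ 2 / (j : ℝ) ^ 2)) (g := fun i => d * i)
        (fun a _ b _ hab => Nat.eq_of_mul_eq_mul_left hd0 hab)]
    refine Finset.sum_le_sum_of_subset_of_nonneg ?_ fun _ _ _ => by positivity
    intro j hj
    simp only [Finset.mem_filter, Finset.mem_Icc] at hj
    obtain ⟨⟨hj1, hj2⟩, k, rfl⟩ := hj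
    simp only [Finset.mem_image, Finset.mem_Icc]
    refine ⟨k, ⟨Nat.pos_of_ne_zero ?_, by nlinarith⟩, rfl⟩
    rintro rfl
    simp at hj1
  simp_rw [h1]
  rw [← Finset.sum_fiberwise (Finset.univ) (fun p => h * p)]
  calc _ ≤ ∑ y : ZMod q, (d : ℝ) * (if y = 0 then 0 else φ (resDist y)) := by
        refine Finset.sum_le_sum fun y _ => ?_
        rw [Finset.sum_congr rfl (g := fun _ => (if y = 0 then 0 else φ (resDist y)))
          (fun p hp => by rw [(Finset.mem_filter.1 hp).2]), Finset.sum_const, nsmul_eq_mul]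
        refine mul_le_mul_of_nonneg_right ?_ (by split_ifs; exacts [le_rfl, hφ _])
        exact_mod_cast card_mul_eq_le h y
    _ ≤ d * (2 * ∑ i ∈ Finset.Icc 1 q, φ i) := by
        rw [← Finset.mul_sum]
        exact mul_le_mul_of_nonneg_left (sum_resDist_le φ hφ) hd0'.le
    _ ≤ d * (2 * (4 * (X / d))) := by gcongr
    _ = 8 * X := by field_simp; ring

lemma sum_Icc_inv_le (n : ℕ) : ∑ i ∈ Finset.Icc 1 n, ((i : ℝ))⁻¹ ≤ 1 + Real.log n := by
  have h := harmonic_le_one_add_log n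
  rw [harmonic_eq_sum_Icc] at h
  push_cast at h
  exact h

lemma min_one_sum_le {ι : Type*} (s : Finset ι) (f : ι → ℝ) (hf : ∀ i ∈ s, 0 ≤ f i) :
    min 1 (∑ i ∈ s, f i) ≤ ∑ i ∈ s, min 1 (f i) := by
  by_cases h : ∃ i ∈ s, 1 ≤ f i
  · obtain ⟨i, hi, h1⟩ := h
    refine (min_le_left _ _).trans ((min_eq_left h1).ge.trans ?_)
    exact Finset.single_le_sum (f := fun i => min 1 (f i))
      (fun j hj => le_min zero_le_one (hf j hj)) hi
  · push Not at h
    refine (min_le_right _ _).trans (Finset.sum_le_sum fun i hi => ?_)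
    rw [min_eq_right (h i hi).le]

open scoped Classical in
/-- Few units `p` modulo `q` have a large resonance sum. -/
lemma card_resonance_gt_le {q : ℕ} [NeZero q] {D : ℝ} (hD : 0 < D) :
    ((Finset.univ.filter fun p : ZMod q => IsUnit p ∧ D ^ 2 < resonance q p).card : ℝ)
      ≤ 16 * q * (1 + Real.log q) / D := by
  have hq : (0 : ℝ) < q := by exact_mod_cast Nat.pos_of_ne_zero (NeZero.ne q)
  let ψ : ZMod q → ZMod q → ℝ := fun h p =>
    if h * p = 0 then 0 else min 1 ((q / (D * resDist h)) ^ 2 / (resDist (h * p) : ℝ) ^ 2)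
  have hψ0 : ∀ h p, 0 ≤ ψ h p := fun h p => by simp only [ψ]; split_ifs <;> positivity
  have h1 : ∀ p : ZMod q, IsUnit p → D ^ 2 < resonance q p → 1 ≤ ∑ h, ψ h p := by
    intro p hp hr
    have h2 : 1 ≤ min 1 (∑ h : ZMod q,
        (q : ℝ) ^ 2 / ((resDist h : ℝ) ^ 2 * (resDist (h * p) : ℝ) ^ 2) / D ^ 2) := by
      rw [← Finset.sum_div]
      refine le_min le_rfl ?_
      rw [le_div_iff₀ (by positivity), one_mul]
      exact hr.le
    refine h2.trans ((min_one_sum_le _ _ fun i _ => by positivity).trans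
      (Finset.sum_le_sum fun h _ => ?_))
    simp only [ψ]
    split_ifs with h0
    · rw [h0]; simp [resDist]
    · refine le_of_eq ?_
      congr 1
      rw [div_pow, mul_pow, div_div, div_div]
      congr 1
      ring
  calc ((Finset.univ.filter fun p : ZMod q => IsUnit p ∧ D ^ 2 < resonance q p).card : ℝ)
      = ∑ p ∈ Finset.univ.filter (fun p : ZMod q => IsUnit p ∧ D ^ 2 < resonance q p), (1 : ℝ) := by
        simp
    _ ≤ ∑ p ∈ Finset.univ.filter (fun p : ZMod q => IsUnit p ∧ D ^ 2 < resonance q p),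
          ∑ h, ψ h p := Finset.sum_le_sum fun p hp => by
            have := (Finset.mem_filter.1 hp).2
            exact h1 p this.1 this.2
    _ ≤ ∑ p, ∑ h, ψ h p := Finset.sum_le_sum_of_subset_of_nonneg (Finset.subset_univ _)
          fun p _ _ => Finset.sum_nonneg fun h _ => hψ0 h p
    _ = ∑ h, ∑ p, ψ h p := Finset.sum_comm
    _ ≤ ∑ h : ZMod q, (if h = 0 then 0 else 8 * (q / D) * ((resDist h : ℝ))⁻¹) := by
        refine Finset.sum_le_sum fun h _ => ?_
        split_ifs with h0
        · simp [ψ, h0]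
        · have hr : (0 : ℝ) < resDist h := by
            exact_mod_cast Nat.pos_of_ne_zero ((resDist_eq_zero h).not.2 h0)
          refine (sum_min_resDist_mul_le h (X := q / (D * resDist h)) (by positivity)).trans ?_
          refine le_of_eq ?_
          field_simp
    _ ≤ 2 * ∑ i ∈ Finset.Icc 1 q, 8 * (q / D) * ((i : ℝ))⁻¹ :=
        sum_resDist_le (fun i => 8 * (q / D) * ((i : ℝ))⁻¹) fun i => by positivity
    _ = 16 * (q / D) * ∑ i ∈ Finset.Icc 1 q, ((i : ℝ))⁻¹ := by rw [← Finset.mul_sum]; ring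
    _ ≤ 16 * (q / D) * (1 + Real.log q) := by
        have := sum_Icc_inv_le q
        gcongr
    _ = _ := by ring

lemma card_le_of_separated {ι : Type*} (S : Finset ι) (f : ι → ℝ) {u v s : ℝ} (hs : 0 < s)
    (huv : u ≤ v) (hf : ∀ x ∈ S, u ≤ f x ∧ f x ≤ v)
    (hsep : ∀ x ∈ S, ∀ y ∈ S, x ≠ y → s ≤ |f x - f y|) :
    (S.card : ℝ) ≤ (v - u) / s + 1 := by
  have h0 : 0 ≤ (v - u) / s := div_nonneg (by linarith) hs.le
  have hcard : S.card ≤ (Finset.range (⌊(v - u) / s⌋₊ + 1)).card := by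
    refine Finset.card_le_card_of_injOn (fun x => ⌊(f x - u) / s⌋₊) ?_ ?_
    · intro x hx
      obtain ⟨h1, h2⟩ := hf x hx
      simp only [Finset.coe_range, Set.mem_Iio]
      exact Nat.lt_succ_of_le (Nat.floor_le_floor (by gcongr))
    · intro x hx y hy hxy
      by_contra hne
      have h3 := hsep x hx y hy hne
      have hx0 : 0 ≤ (f x - u) / s := div_nonneg (by linarith [(hf x hx).1]) hs.le
      have hy0 : 0 ≤ (f y - u) / s := div_nonneg (by linarith [(hf y hy).1]) hs.le
      have e1 := Nat.floor_le hx0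
      have e2 := Nat.lt_floor_add_one ((f x - u) / s)
      have e3 := Nat.floor_le hy0
      have e4 := Nat.lt_floor_add_one ((f y - u) / s)
      simp only at hxy
      rw [hxy] at e1 e2
      have e5 : |(f x - u) / s - (f y - u) / s| < 1 := by
        rw [abs_lt]; constructor <;> linarith
      rw [← sub_div, abs_div, abs_of_pos hs, div_lt_one hs] at e5
      have : f x - u - (f y - u) = f x - f y := by ring
      rw [this] at e5
      linarith
  rw [Finset.card_range] at hcard
  have h5 : (S.card : ℝ) ≤ (⌊(v - u) / s⌋₊ : ℝ) + 1 := by exact_mod_cast hcard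
  linarith [Nat.floor_le h0]

/-- A finite set of natural numbers squeezed between an open and a closed interval. -/
lemma abs_card_sub_le (A : Finset ℕ) {lo hi : ℝ} (hlo : 0 ≤ lo)
    (h1 : ∀ N ∈ A, lo ≤ (N : ℝ) ∧ (N : ℝ) ≤ hi) (h2 : ∀ N : ℕ, lo < N → (N : ℝ) < hi → N ∈ A) :
    |(A.card : ℝ) - max 0 (hi - lo)| ≤ 1 := by
  rw [abs_le]
  constructor
  · have hsub : Finset.Ioo ⌊lo⌋₊ ⌈hi⌉₊ ⊆ A := by
      intro N hN
      rw [Finset.mem_Ioo] at hN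
      exact h2 N ((Nat.floor_lt hlo).1 hN.1) (Nat.lt_ceil.1 hN.2)
    have hc := Finset.card_le_card hsub
    rw [Nat.card_Ioo] at hc
    have hc' : (⌈hi⌉₊ : ℝ) - ⌊lo⌋₊ - 1 ≤ A.card := by
      have : ⌈hi⌉₊ ≤ A.card + ⌊lo⌋₊ + 1 := by omega
      have : (⌈hi⌉₊ : ℝ) ≤ A.card + ⌊lo⌋₊ + 1 := by exact_mod_cast this
      linarith
    have := Nat.le_ceil hi
    have := Nat.floor_le hlo
    rcases max_cases 0 (hi - lo) with ⟨h, _⟩ | ⟨h, _⟩ <;> rw [h]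
    · have : (0 : ℝ) ≤ A.card := Nat.cast_nonneg _
      linarith
    · linarith
  · by_cases hh : lo ≤ hi
    · have := card_le_of_separated A (fun n : ℕ => (n : ℝ)) one_pos hh h1 (by
        intro x _ y _ hxy
        have h3 : (1 : ℤ) ≤ |(x : ℤ) - y| := by
          apply Int.one_le_abs
          omega
        have : (1 : ℝ) ≤ |(((x : ℤ) : ℝ)) - ((y : ℤ) : ℝ)| := by exact_mod_cast h3
        simpa using this)
      have := le_max_right 0 (hi - lo)
      linarith
    · have : A = ∅ := by
        rw [Finset.eq_empty_iff_forall_notMem]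
        intro N hN
        obtain ⟨h3, h4⟩ := h1 N hN
        linarith
      have := le_max_left 0 (hi - lo)
      rw [‹A = ∅›]
      simp
      linarith

lemma exists_norm_nsmul_ge {β : UnitAddCircle} (hβ : β ≠ 0) :
    ∃ δ : ℝ, 0 < δ ∧ ∀ m : ℕ, δ ≤ ‖(4 * m + 1) • β‖ ∨ δ ≤ ‖(4 * m + 3) • β‖ := by
  by_cases h : 2 • β = 0
  · refine ⟨‖β‖, norm_pos_iff.2 hβ, fun m => Or.inl ?_⟩
    rw [show 4 * m + 1 = (2 * m) * 2 + 1 by ring, add_nsmul, mul_nsmul', h]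
    simp
  · refine ⟨‖2 • β‖ / 2, half_pos (norm_pos_iff.2 h), fun m => ?_⟩
    by_contra! hc
    have h1 : 2 • β = (4 * m + 3) • β - (4 * m + 1) • β := by
      rw [show 4 * m + 3 = 2 + (4 * m + 1) by ring, add_nsmul _ 2]
      simp
    have h2 := norm_sub_le ((4 * m + 3) • β) ((4 * m + 1) • β)
    rw [← h1] at h2
    linarith

open scoped Classical in
/-- Denominators used at scale `8 * n`. -/
noncomputable def goodDenom (β : UnitAddCircle) (δ : ℝ) (n : ℕ) : Finset ℕ :=
  (Finset.Ico (8 * n) (12 * n)).filter fun q => Odd q ∧ δ ≤ ‖q • β‖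

open scoped Classical in
/-- Numerators `p` with `p / q` between `u` and `v`. -/
noncomputable def numer (u v : ℝ) (n q : ℕ) : Finset ℕ :=
  (Finset.range (12 * n)).filter fun p => u * q ≤ p ∧ (p : ℝ) ≤ v * q

open scoped Classical in
/-- Reduced fractions in `[u, v]` with a good denominator and small resonance sum. -/
noncomputable def goodFrac (β : UnitAddCircle) (δ D u v : ℝ) (n : ℕ) : Finset (Σ _ : ℕ, ℕ) :=
  (goodDenom β δ n).sigma fun q => (numer u v n q).filter fun p =>
    p.Coprime q ∧ ∀ _ : NeZero q, resonance q (p : ZMod q) ≤ D ^ 2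

lemma le_card_goodDenom {β : UnitAddCircle} {δ : ℝ}
    (hδ : ∀ m : ℕ, δ ≤ ‖(4 * m + 1) • β‖ ∨ δ ≤ ‖(4 * m + 3) • β‖) (n : ℕ) :
    n ≤ (goodDenom β δ n).card := by
  classical
  conv_lhs => rw [← Finset.card_range n]
  refine Finset.card_le_card_of_injOn
    (fun i => if δ ≤ ‖(4 * (2 * n + i) + 1) • β‖ then 4 * (2 * n + i) + 1
      else 4 * (2 * n + i) + 3) ?_ ?_
  · intro i hi
    have hi' : i < n := by simpa using hi
    simp only [goodDenom, Finset.coe_filter, Finset.mem_Ico]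
    rcases hδ (2 * n + i) with h | h
    · simp only [h, if_true]
      exact ⟨⟨by omega, by omega⟩, ⟨2 * (2 * n + i), by ring⟩, h⟩
    · split_ifs with h'
      · exact ⟨⟨by omega, by omega⟩, ⟨2 * (2 * n + i), by ring⟩, h'⟩
      · exact ⟨⟨by omega, by omega⟩, ⟨2 * (2 * n + i) + 1, by ring⟩, h⟩
  · intro i _ j _ hij
    simp only at hij
    split_ifs at hij <;> omega

lemma le_card_numer {u v : ℝ} (hu : 0 ≤ u) (hv : v ≤ 1) {n q : ℕ} (hq : q < 12 * n) :
    (v - u) * q - 1 ≤ (numer u v n q).card := by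
  have h := abs_card_sub_le (numer u v n q) (lo := u * q) (hi := v * q) (by positivity)
    (fun N hN => (Finset.mem_filter.1 hN).2) (fun N h1 h2 => by
      refine Finset.mem_filter.2 ⟨?_, h1.le, h2.le⟩
      rw [Finset.mem_range]
      have : (N : ℝ) < q := lt_of_lt_of_le h2 (mul_le_of_le_one_left (Nat.cast_nonneg _) hv)
      have : N < q := by exact_mod_cast this
      omega)
  have := (abs_le.1 h).1
  have := le_max_right 0 (v * q - u * q)
  linarith

lemma separated_of_dvd {g x y : ℕ} (hx : g ∣ x) (hy : g ∣ y) (h : x ≠ y) :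
    (g : ℝ) ≤ |(x : ℝ) - y| := by
  have h3 : (g : ℤ) ∣ (x : ℤ) - y := dvd_sub (Int.natCast_dvd_natCast.2 hx)
    (Int.natCast_dvd_natCast.2 hy)
  have h4 : (g : ℤ) ≤ |(x : ℤ) - y| :=
    Int.le_of_dvd (abs_pos.2 (by omega)) ((dvd_abs _ _).2 h3)
  have : (g : ℝ) ≤ |(((x : ℤ) : ℝ)) - ((y : ℤ) : ℝ)| := by exact_mod_cast h4
  simpa using this

lemma card_numer_dvd_le {u v : ℝ} (huv : u ≤ v) {n q g : ℕ} (hg : 0 < g) :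
    (((numer u v n q).filter fun p => g ∣ p).card : ℝ) ≤ (v - u) * q / g + 1 := by
  have := card_le_of_separated ((numer u v n q).filter fun p => g ∣ p) (fun n : ℕ => (n : ℝ))
    (u := u * q) (v := v * q) (s := g) (by exact_mod_cast hg) (by gcongr)
    (fun p hp => (Finset.mem_filter.1 (Finset.mem_filter.1 hp).1).2)
    (fun x hx y hy h => separated_of_dvd (Finset.mem_filter.1 hx).2 (Finset.mem_filter.1 hy).2 h)
  rwa [← sub_mul] at this

lemma card_goodDenom_dvd_le {β : UnitAddCircle} {δ : ℝ} {n g : ℕ} (hg : 0 < g) :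
    (((goodDenom β δ n).filter fun q => g ∣ q).card : ℝ) ≤ 2 * n / g + 1 := by
  have hg' : (0 : ℝ) < g := by exact_mod_cast hg
  have := card_le_of_separated ((goodDenom β δ n).filter fun q => g ∣ q) (fun n : ℕ => (n : ℝ))
    (u := 8 * n) (v := 12 * n) (s := 2 * g) (by positivity) (by gcongr; norm_num)
    (fun p hp => by
      have h1 := Finset.mem_Ico.1 (Finset.mem_filter.1 (Finset.mem_filter.1 hp).1).1
      have h2 : p ≤ 12 * n := h1.2.le
      exact ⟨by exact_mod_cast h1.1, by exact_mod_cast h2⟩)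
    (fun x hx y hy h => by
      rw [Finset.mem_filter] at hx hy
      have hox : Odd x := (Finset.mem_filter.1 hx.1).2.1
      have hoy : Odd y := (Finset.mem_filter.1 hy.1).2.1
      have h3 : ((2 * g : ℕ) : ℤ) ∣ (x : ℤ) - y := by
        push_cast
        have h2 : (2 : ℤ) ∣ (x : ℤ) - y := by
          obtain ⟨a, ha⟩ := hox
          obtain ⟨c, hc⟩ := hoy
          exact ⟨a - c, by rw [ha, hc]; push_cast; ring⟩
        have hgd : (g : ℤ) ∣ (x : ℤ) - y := dvd_sub (Int.natCast_dvd_natCast.2 hx.2)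
          (Int.natCast_dvd_natCast.2 hy.2)
        refine IsCoprime.mul_dvd ?_ h2 hgd
        have hog : Odd g := Odd.of_dvd_nat hox hx.2
        rw [show (2 : ℤ) = ((2 : ℕ) : ℤ) by rfl, Nat.isCoprime_iff_coprime]
        exact (Nat.coprime_two_left).2 hog
      have h4 : ((2 * g : ℕ) : ℤ) ≤ |(x : ℤ) - y| :=
        Int.le_of_dvd (abs_pos.2 (by omega)) ((dvd_abs _ _).2 h3)
      have : ((2 * g : ℕ) : ℝ) ≤ |(((x : ℤ) : ℝ)) - ((y : ℤ) : ℝ)| := by exact_mod_cast h4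
      simpa using this)
  refine this.trans (le_of_eq ?_)
  field_simp
  ring

lemma sum_odd_inv_sq_le (M : ℕ) :
    ∑ j ∈ Finset.Icc 1 M, (((2 * j + 1 : ℕ) : ℝ) ^ 2)⁻¹ ≤ 1 / 4 := by
  have h : ∀ M : ℕ, ∑ j ∈ Finset.Icc 1 M, (((2 * j + 1 : ℕ) : ℝ) ^ 2)⁻¹
      ≤ 1 / 4 - 1 / (4 * (M + 1)) := by
    intro M
    induction M with
    | zero => simp
    | succ M ih =>
      rw [Finset.sum_Icc_succ_top (by omega)]
      have : (((2 * (M + 1) + 1 : ℕ) : ℝ) ^ 2)⁻¹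
          ≤ 1 / (4 * ((M : ℝ) + 1)) - 1 / (4 * (((M + 1 : ℕ) : ℝ) + 1)) := by
        have e : 1 / (4 * ((M : ℝ) + 1)) - 1 / (4 * (((M + 1 : ℕ) : ℝ) + 1))
          = (4 * ((M : ℝ) + 1) * (M + 2))⁻¹ := by
          push_cast
          field_simp
          ring
        rw [e]
        push_cast
        gcongr
        nlinarith
      linarith
  refine (h M).trans ?_
  have : 0 ≤ 1 / (4 * ((M : ℝ) + 1)) := by positivity
  linarith

open scoped Classical in
lemma card_numer_resonance_le {u v D : ℝ} (hD : 0 < D) (hv : v ≤ 1) {n q : ℕ} (hq : 1 < q) :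
    (((numer u v n q).filter fun p : ℕ => p.Coprime q ∧
      ∃ _ : NeZero q, D ^ 2 < resonance q (p : ZMod q)).card : ℝ)
      ≤ 16 * q * (1 + Real.log q) / D := by
  have : NeZero q := ⟨by omega⟩
  refine le_trans ?_ (card_resonance_gt_le (q := q) hD)
  norm_cast
  have hlt : ∀ p ∈ (numer u v n q).filter fun p : ℕ => p.Coprime q ∧
      ∃ _ : NeZero q, D ^ 2 < resonance q (p : ZMod q), p < q := by
    intro p hp
    rw [Finset.mem_filter] at hp
    have h1 := (Finset.mem_filter.1 hp.1).2.2
    have h2 : (p : ℝ) ≤ q := h1.trans (mul_le_of_le_one_left (Nat.cast_nonneg _) hv)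
    have h3 : p ≤ q := by exact_mod_cast h2
    refine lt_of_le_of_ne h3 fun h => ?_
    have h4 := hp.2.1
    rw [h, Nat.coprime_self] at h4
    omega
  refine Finset.card_le_card_of_injOn (fun p : ℕ => (p : ZMod q)) ?_ ?_
  · intro p hp
    rw [Finset.mem_coe, Finset.mem_filter] at hp
    obtain ⟨-, hc, h0, hr⟩ := hp
    rw [Finset.mem_coe, Finset.mem_filter]
    exact ⟨Finset.mem_univ _, (ZMod.isUnit_iff_coprime _ _).2 hc, hr⟩
  · intro x hx y hy hxy
    have h1 := hlt x hx
    have h2 := hlt y hy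
    have h3 := congrArg ZMod.val hxy
    simpa [ZMod.val_natCast, Nat.mod_eq_of_lt h1, Nat.mod_eq_of_lt h2] using h3

open scoped Classical in
lemma card_numer_le {β : UnitAddCircle} {δ u v D : ℝ} (hD : 0 < D) (hv : v ≤ 1) {n q : ℕ}
    (hq : q ∈ goodDenom β δ n) :
    ((numer u v n q).card : ℝ) ≤ (((numer u v n q).filter fun p : ℕ =>
        p.Coprime q ∧ ∀ _ : NeZero q, resonance q (p : ZMod q) ≤ D ^ 2).card : ℝ)
      + ∑ j ∈ Finset.Icc 1 (6 * n), (if (2 * j + 1) ∣ q then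
          (((numer u v n q).filter fun p => (2 * j + 1) ∣ p).card : ℝ) else 0)
      + 16 * q * (1 + Real.log q) / D := by
  obtain ⟨hq1, hodd, -⟩ := Finset.mem_filter.1 hq
  rw [Finset.mem_Ico] at hq1
  have hres := card_numer_resonance_le (u := u) (v := v) (n := n) hD hv (show 1 < q by omega)
  refine le_trans ?_ (add_le_add_right hres _)
  have hsub : numer u v n q ⊆ (((numer u v n q).filter fun p : ℕ =>
        p.Coprime q ∧ ∀ _ : NeZero q, resonance q (p : ZMod q) ≤ D ^ 2)
      ∪ (Finset.Icc 1 (6 * n)).biUnion fun j => if (2 * j + 1) ∣ q then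
          ((numer u v n q).filter fun p => (2 * j + 1) ∣ p) else ∅)
      ∪ ((numer u v n q).filter fun p : ℕ => p.Coprime q ∧
      ∃ _ : NeZero q, D ^ 2 < resonance q (p : ZMod q)) := by
    intro p hp
    rw [Finset.mem_union, Finset.mem_union]
    by_cases hc : p.Coprime q
    · by_cases hr : ∀ _ : NeZero q, resonance q (p : ZMod q) ≤ D ^ 2
      · exact Or.inl (Or.inl (Finset.mem_filter.2 ⟨hp, hc, hr⟩))
      · push Not at hr
        exact Or.inr (Finset.mem_filter.2 ⟨hp, hc, hr⟩)
    · refine Or.inl (Or.inr ?_)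
      obtain ⟨j, hj⟩ : Odd (p.gcd q) := Odd.of_dvd_nat hodd (Nat.gcd_dvd_right _ _)
      have hle : p.gcd q ≤ q := Nat.le_of_dvd (by omega) (Nat.gcd_dvd_right _ _)
      have hne : p.gcd q ≠ 1 := hc
      rw [Finset.mem_biUnion]
      refine ⟨j, Finset.mem_Icc.2 ⟨by omega, by omega⟩, ?_⟩
      rw [if_pos (hj ▸ Nat.gcd_dvd_right _ _)]
      exact Finset.mem_filter.2 ⟨hp, hj ▸ Nat.gcd_dvd_left _ _⟩
  have h1 := (Finset.card_le_card hsub).trans ((Finset.card_union_le _ _).trans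
    (add_le_add_left ((Finset.card_union_le _ _).trans
      (add_le_add_right Finset.card_biUnion_le _)) _))
  have h2 := (Nat.cast_le (α := ℝ)).2 h1
  push_cast at h2
  refine h2.trans (le_of_eq ?_)
  congr 2
  refine Finset.sum_congr rfl fun j _ => ?_
  split_ifs <;> simp

lemma le_card_goodFrac {β : UnitAddCircle} {δ : ℝ}
    (hδ : ∀ m : ℕ, δ ≤ ‖(4 * m + 1) • β‖ ∨ δ ≤ ‖(4 * m + 3) • β‖) {u v : ℝ} (hu : 0 ≤ u)
    (huv : u < v) (hv : v ≤ 1) :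
    ∃ n₀ : ℕ, ∀ n ≥ n₀, ∀ D : ℝ, 1152 / (v - u) * (1 + Real.log (12 * n)) ≤ D →
      (v - u) * n ^ 2 ≤ (goodFrac β δ D u v n).card := by
  classical

  set l := v - u with hl
  have hl0 : 0 < l := by linarith
  have hlog : ∀ᶠ n : ℕ in atTop, 21 + 14 * Real.log (12 * n) ≤ l / 2 * n := by
    have h1 := (Real.isLittleO_log_id_atTop.bound (show (0 : ℝ) < l / 2 / 2 / 14 / 12 by positivity))
    have h2 : Tendsto (fun n : ℕ => 12 * (n : ℝ)) atTop atTop :=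
      tendsto_natCast_atTop_atTop.const_mul_atTop (by norm_num)
    filter_upwards [h2.eventually h1, h2.eventually_ge_atTop 12,
      tendsto_natCast_atTop_atTop.eventually_ge_atTop (84 / l)] with n hn hn2 hn3
    rw [id, Real.norm_of_nonneg (Real.log_nonneg (by linarith)),
      Real.norm_of_nonneg (by linarith)] at hn
    rw [div_le_iff₀ hl0] at hn3
    linarith
  obtain ⟨n₁, hn₁⟩ := eventually_atTop.1 hlog
  refine ⟨max n₁ (max 1 ⌈1 / l⌉₊), fun n hn D hDn => ?_⟩
  have hnn : 1 ≤ n := le_trans (le_trans (le_max_left _ _) (le_max_right _ _)) hn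
  have hnl : 1 / l ≤ n := Nat.ceil_le.1 (le_trans (le_trans (le_max_right _ _) (le_max_right _ _)) hn)
  have hlogn := hn₁ n (le_trans (le_max_left _ _) hn)
  have hn' : (1 : ℝ) ≤ n := by exact_mod_cast hnn
  have hlog0 : 0 ≤ Real.log (12 * n) := Real.log_nonneg (by linarith)
  have hD : 0 < D := lt_of_lt_of_le (by positivity) hDn
  rw [div_le_iff₀ hl0] at hnl
  set GD := goodDenom β δ n with hGD
  have hc1 : (n : ℝ) ≤ GD.card := by exact_mod_cast le_card_goodDenom hδ n
  have hc2 : (GD.card : ℝ) ≤ 3 * n := by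
    have := card_goodDenom_dvd_le (β := β) (δ := δ) (n := n) (g := 1) one_pos
    rw [Finset.filter_true_of_mem (fun q _ => one_dvd q)] at this
    push_cast at this
    linarith
  have hmem : ∀ q ∈ GD, 8 * (n : ℝ) ≤ q ∧ (q : ℝ) ≤ 12 * n ∧ q < 12 * n := by
    intro q hq
    have h := Finset.mem_Ico.1 (Finset.mem_filter.1 hq).1
    have h' := h.2.le
    exact ⟨by exact_mod_cast h.1, by exact_mod_cast h', h.2⟩
  have hlow : (n : ℝ) * (8 * l * n - 1) ≤ ∑ q ∈ GD, ((numer u v n q).card : ℝ) := by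
    calc (n : ℝ) * (8 * l * n - 1) ≤ GD.card * (8 * l * n - 1) := by
          gcongr
          nlinarith
      _ = ∑ q ∈ GD, (8 * l * n - 1) := by rw [Finset.sum_const, nsmul_eq_mul]
      _ ≤ _ := Finset.sum_le_sum fun q hq => by
          obtain ⟨h1, -, h3⟩ := hmem q hq
          refine le_trans ?_ (le_card_numer hu hv h3)
          rw [← hl]
          nlinarith
  have hgcd : ∑ q ∈ GD, ∑ j ∈ Finset.Icc 1 (6 * n), (if (2 * j + 1) ∣ q then
      (((numer u v n q).filter fun p => (2 * j + 1) ∣ p).card : ℝ) else 0)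
      ≤ 6 * l * n ^ 2 + 14 * n * (1 + Real.log (12 * n)) + 6 * n := by
    rw [Finset.sum_comm]
    have h1 : ∀ j ∈ Finset.Icc 1 (6 * n), ∑ q ∈ GD, (if (2 * j + 1) ∣ q then
      (((numer u v n q).filter fun p => (2 * j + 1) ∣ p).card : ℝ) else 0)
        ≤ 24 * l * n ^ 2 * (((2 * j + 1 : ℕ) : ℝ) ^ 2)⁻¹ + 14 * n * (j : ℝ)⁻¹ + 1 := by
      intro j hj
      have hj1 : (1 : ℝ) ≤ j := by exact_mod_cast (Finset.mem_Icc.1 hj).1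
      rw [← Finset.sum_filter]
      set g : ℝ := ((2 * j + 1 : ℕ) : ℝ) with hg
      have hg0 : 0 < g := by rw [hg]; positivity
      have hgj : j ≤ g := by rw [hg]; push_cast; linarith
      calc ∑ q ∈ GD.filter fun q => (2 * j + 1) ∣ q,
            (((numer u v n q).filter fun p => (2 * j + 1) ∣ p).card : ℝ)
          ≤ ∑ q ∈ GD.filter fun q => (2 * j + 1) ∣ q, (12 * l * n / g + 1) := by
            refine Finset.sum_le_sum fun q hq => ?_
            obtain ⟨-, h2, -⟩ := hmem q (Finset.mem_filter.1 hq).1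
            refine (card_numer_dvd_le huv.le (by omega)).trans ?_
            rw [← hl, ← hg]
            have : l * q ≤ 12 * l * n := by nlinarith
            gcongr
        _ = (GD.filter fun q => (2 * j + 1) ∣ q).card * (12 * l * n / g + 1) := by
            rw [Finset.sum_const, nsmul_eq_mul]
        _ ≤ (2 * n / g + 1) * (12 * l * n / g + 1) := by
            gcongr
            exact card_goodDenom_dvd_le (by omega)
        _ = 24 * l * n ^ 2 * (g ^ 2)⁻¹ + (2 * n + 12 * l * n) * g⁻¹ + 1 := by
            field_simp
            ring
        _ ≤ _ := by
            have : (2 * n + 12 * l * n) ≤ 14 * (n : ℝ) := by nlinarith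
            gcongr
    refine (Finset.sum_le_sum h1).trans ?_
    rw [Finset.sum_add_distrib, Finset.sum_add_distrib, ← Finset.mul_sum, ← Finset.mul_sum,
      Finset.sum_const, Nat.card_Icc, nsmul_eq_mul]
    have h2 := sum_odd_inv_sq_le (6 * n)
    have h3 := sum_Icc_inv_le (6 * n)
    have h4 : Real.log ((6 * n : ℕ) : ℝ) ≤ Real.log (12 * n) :=
      Real.log_le_log (by push_cast; linarith) (by push_cast; linarith)
    have h5 : 24 * l * n ^ 2 * ∑ j ∈ Finset.Icc 1 (6 * n), (((2 * j + 1 : ℕ) : ℝ) ^ 2)⁻¹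
        ≤ 24 * l * n ^ 2 * (1 / 4) := by gcongr
    have h6 : 14 * (n : ℝ) * ∑ j ∈ Finset.Icc 1 (6 * n), (j : ℝ)⁻¹
        ≤ 14 * n * (1 + Real.log (12 * n)) := by
      gcongr
      linarith
    have h7 : ((6 * n + 1 - 1 : ℕ) : ℝ) = 6 * n := by simp
    rw [h7]
    linarith
  have hres : ∑ q ∈ GD, 16 * q * (1 + Real.log q) / D ≤ l / 2 * n ^ 2 := by
    calc ∑ q ∈ GD, 16 * q * (1 + Real.log q) / D ≤ ∑ q ∈ GD, l * n / 6 := by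
          refine Finset.sum_le_sum fun q hq => ?_
          obtain ⟨h1, h2, -⟩ := hmem q hq
          have h3 : Real.log q ≤ Real.log (12 * n) := Real.log_le_log (by linarith) h2
          rw [div_le_iff₀ hD]
          have h4 : l * n / 6 * (1152 / l * (1 + Real.log (12 * n))) ≤ l * n / 6 * D := by gcongr
          refine le_trans ?_ h4
          have h5 : l * n / 6 * (1152 / l * (1 + Real.log (12 * n)))
            = 16 * (12 * n) * (1 + Real.log (12 * n)) := by
            field_simp
            ring
          rw [h5]
          have : 0 ≤ Real.log q := Real.log_nonneg (by linarith)
          gcongr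
      _ = GD.card * (l * n / 6) := by rw [Finset.sum_const, nsmul_eq_mul]
      _ ≤ 3 * n * (l * n / 6) := by gcongr
      _ = _ := by ring
  have hcard : ((goodFrac β δ D u v n).card : ℝ) = ∑ q ∈ GD, (((numer u v n q).filter fun p : ℕ =>
        p.Coprime q ∧ ∀ _ : NeZero q, resonance q (p : ZMod q) ≤ D ^ 2).card : ℝ) := by
    rw [goodFrac, Finset.card_sigma]
    push_cast
    rfl
  have htot := Finset.sum_le_sum fun q hq =>
    card_numer_le (β := β) (δ := δ) (u := u) (v := v) (n := n) hD hv hq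
  rw [Finset.sum_add_distrib, Finset.sum_add_distrib, ← hcard] at htot
  nlinarith

lemma card_mul_le_volume_biUnion_ball (F : Finset ℝ) {r : ℝ} (hr : 0 ≤ r)
    (hsep : ∀ x ∈ F, ∀ y ∈ F, x ≠ y → 2 * r ≤ |x - y|) :
    volume.real (⋃ x ∈ F, Metric.ball x r) = F.card * (2 * r) := by
  rw [measureReal_biUnion_finset]
  · rw [← nsmul_eq_mul, ← Finset.sum_const]
    exact Finset.sum_congr rfl fun x _ => Real.volume_real_ball hr
  · intro x hx y hy hxy
    refine Metric.ball_disjoint_ball ?_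
    rw [Real.dist_eq]
    linarith [hsep x hx y hy hxy]
  · exact fun x _ => measurableSet_ball

lemma volume_biUnion_ball_inter_le (F G : Finset ℝ) {r s m : ℝ} (hs : 0 ≤ s)
    (hm : ∀ x ∈ F, ((G.filter fun y => |x - y| < r + s).card : ℝ) ≤ m) :
    volume.real ((⋃ x ∈ F, Metric.ball x r) ∩ ⋃ y ∈ G, Metric.ball y s)
      ≤ F.card * (m * (2 * s)) := by
  have hsub : ((⋃ x ∈ F, Metric.ball x r) ∩ ⋃ y ∈ G, Metric.ball y s)
      ⊆ ⋃ x ∈ F, ⋃ y ∈ G.filter fun y => |x - y| < r + s, Metric.ball y s := by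
    rintro z ⟨h1, h2⟩
    simp only [mem_iUnion, exists_prop, Metric.mem_ball, Real.dist_eq] at h1 h2 ⊢
    obtain ⟨x, hx, hzx⟩ := h1
    obtain ⟨y, hy, hzy⟩ := h2
    refine ⟨x, hx, y, Finset.mem_filter.2 ⟨hy, ?_⟩, hzy⟩
    rw [abs_sub_comm] at hzx
    calc |x - y| ≤ |x - z| + |z - y| := abs_sub_le _ _ _
      _ < r + s := by linarith
  refine (measureReal_mono hsub (by
    refine ((measure_biUnion_finset_le _ _).trans_lt ?_).ne
    refine ENNReal.sum_lt_top.2 fun x _ => ?_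
    refine (measure_biUnion_finset_le _ _).trans_lt ?_
    exact ENNReal.sum_lt_top.2 fun y _ => measure_ball_lt_top)).trans ?_
  refine (measureReal_biUnion_finset_le _ _).trans ?_
  rw [← nsmul_eq_mul, ← Finset.sum_const]
  refine Finset.sum_le_sum fun x hx => ?_
  refine (measureReal_biUnion_finset_le _ _).trans ?_
  simp only [Real.volume_real_ball hs]
  rw [Finset.sum_const, nsmul_eq_mul]
  have := hm x hx
  gcongr

lemma le_volume_iUnion_of_quasi_independent {V : ℕ → Set ℝ} (hV : ∀ k, MeasurableSet (V k))
    (hfin : ∀ k, volume (V k) ≠ ⊤) {a : ℕ → ℝ} {l C : ℝ} {m : ℕ}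
    (h1 : ∀ k ≥ m, 2 * l * a k ≤ volume.real (V k))
    (hl : 0 ≤ l) (hC : 0 ≤ C)
    (h2 : ∀ k ≥ m, ∀ k' > k, volume.real (V k ∩ V k') ≤ C * l * (a k * a k')) (M : ℕ) :
    l * (2 * ∑ k ∈ Finset.Ico m M, a k - C / 2 * (∑ k ∈ Finset.Ico m M, a k) ^ 2)
      ≤ volume.real (⋃ k ∈ Finset.Ico m M, V k) := by
  induction M with
  | zero => simp
  | succ M ih =>
    rcases lt_or_ge M m with h | h
    · rw [Finset.Ico_eq_empty (by omega)]; simp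
    · rw [← Finset.insert_Ico_right_eq_Ico_add_one h, Finset.sum_insert (by simp)]
      have hU : (⋃ k ∈ insert M (Finset.Ico m M), V k) = (⋃ k ∈ Finset.Ico m M, V k) ∪ V M := by
        rw [Finset.set_biUnion_insert, union_comm]
      rw [hU]
      have hUfin : volume (⋃ k ∈ Finset.Ico m M, V k) ≠ ⊤ :=
        ((measure_biUnion_finset_le _ _).trans_lt
          (ENNReal.sum_lt_top.2 fun k _ => (hfin k).lt_top)).ne
      have h3 := measureReal_union_add_inter (μ := volume) (s := ⋃ k ∈ Finset.Ico m M, V k)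
        (hV M) hUfin (hfin M)
      have h4 : volume.real ((⋃ k ∈ Finset.Ico m M, V k) ∩ V M)
          ≤ C * l * ((∑ k ∈ Finset.Ico m M, a k) * a M) := by
        rw [Finset.sum_mul, Finset.mul_sum]
        have : ((⋃ k ∈ Finset.Ico m M, V k) ∩ V M) = ⋃ k ∈ Finset.Ico m M, (V k ∩ V M) := by
          simp only [iUnion_inter]
        rw [this]
        refine (measureReal_biUnion_finset_le _ _).trans (Finset.sum_le_sum fun k hk => ?_)
        rw [Finset.mem_Ico] at hk
        exact h2 k hk.1 M hk.2
      have h5 := h1 M h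
      have h6 : 0 ≤ C * l * (a M) ^ 2 := by positivity
      nlinarith

lemma exists_sum_Ico_between {ρ t : ℝ} (hρ : 0 < ρ) (ht : ρ ≤ t) (m : ℕ) :
    ∃ M, t ≤ ∑ k ∈ Finset.Ico (m + 1) M, ρ / (k : ℝ) ∧
      ∑ k ∈ Finset.Ico (m + 1) M, ρ / (k : ℝ) ≤ 2 * t := by
  classical
  have hex : ∃ M, t ≤ ∑ k ∈ Finset.Ico (m + 1) M, ρ / (k : ℝ) := by
    have h1 := Real.tendsto_sum_range_one_div_nat_succ_atTop
    obtain ⟨M, hM⟩ := (h1.eventually_ge_atTop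
      (t / ρ + ∑ i ∈ Finset.range m, (1 / ((i : ℝ) + 1)))).exists_forall_of_atTop
    refine ⟨max M m + 1, ?_⟩
    have h2 := hM (max M m) (le_max_left _ _)
    rw [← Finset.sum_range_add_sum_Ico _ (le_max_right M m)] at h2
    have h3 : ∑ k ∈ Finset.Ico (m + 1) (max M m + 1), ρ / (k : ℝ)
        = ρ * ∑ k ∈ Finset.Ico m (max M m), 1 / ((k : ℝ) + 1) := by
      rw [← Finset.sum_Ico_add' (fun k : ℕ => ρ / (k : ℝ)), Finset.mul_sum]
      refine Finset.sum_congr rfl fun k _ => ?_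
      push_cast
      ring
    rw [h3]
    have h4 : t / ρ ≤ ∑ k ∈ Finset.Ico m (max M m), 1 / ((k : ℝ) + 1) := by linarith
    rw [div_le_iff₀ hρ] at h4
    linarith
  refine ⟨Nat.find hex, Nat.find_spec hex, ?_⟩
  have hpos : Nat.find hex ≠ 0 := by
    intro h0
    have := Nat.find_spec hex
    rw [h0] at this
    simp at this
    linarith
  obtain ⟨M, hM⟩ := Nat.exists_eq_succ_of_ne_zero hpos
  have h1 := Nat.find_min hex (m := M) (by omega)
  rw [hM]
  push Not at h1
  rcases lt_or_ge M (m + 1) with h | h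
  · rw [Nat.succ_eq_add_one, Finset.Ico_eq_empty (by omega)]
    simp
    linarith
  · rw [Nat.succ_eq_add_one, Finset.sum_Ico_succ_top h]
    have hM1 : (1 : ℝ) ≤ M := by exact_mod_cast (by omega : 1 ≤ M)
    have : ρ / (M : ℝ) ≤ ρ := div_le_self hρ.le hM1
    linarith

lemma le_volume_iUnion_ball_of_separated {F : ℕ → Finset ℝ} {u v ρ : ℝ} (huv : u < v) {m : ℕ}
    (hF : ∀ k, ∀ x ∈ F k, u ≤ x ∧ x ≤ v)
    (hsep : ∀ k l, ∀ x ∈ F k, ∀ y ∈ F l, (k ≠ l ∨ x ≠ y) → (144 * 2 ^ (k + l))⁻¹ ≤ |x - y|)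
    (hcard : ∀ k > m, (v - u) * 4 ^ k ≤ (F k).card)
    (hm : ∀ k > m, 1 ≤ (v - u) * 4 ^ k) (hρ : 0 < ρ) (hρ' : ρ ≤ 1 / 600000) :
    ∃ M, (v - u) / 600000 ≤
      volume.real (⋃ k ∈ Finset.Ico (m + 1) M, ⋃ x ∈ F k, Metric.ball x (ρ / (4 ^ k * k))) := by
  set l := v - u with hl
  have hl0 : 0 < l := by linarith
  obtain ⟨M, hM1, hM2⟩ := exists_sum_Ico_between hρ hρ' m
  refine ⟨M, ?_⟩
  have hr : ∀ k : ℕ, 0 ≤ ρ / (4 ^ k * (k : ℝ)) := fun k => by positivity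
  have h1 : ∀ k ≥ m + 1, 2 * l * (ρ / k) ≤
      volume.real (⋃ x ∈ F k, Metric.ball x (ρ / (4 ^ k * k))) := by
    intro k hk
    have hk1 : (1 : ℝ) ≤ k := by exact_mod_cast (by omega : 1 ≤ k)
    rw [card_mul_le_volume_biUnion_ball _ (hr k)]
    · have := hcard k hk
      calc 2 * l * (ρ / k) = l * 4 ^ k * (2 * (ρ / (4 ^ k * k))) := by field_simp
        _ ≤ _ := by gcongr
    · intro x hx y hy hxy
      refine le_trans ?_ (hsep k k x hx y hy (Or.inr hxy))
      rw [← two_mul, pow_mul, show (2 : ℝ) ^ 2 = 4 by norm_num, ← mul_div_assoc,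
        div_le_iff₀ (by positivity), mul_inv]
      have : (144 : ℝ)⁻¹ * (4 ^ k)⁻¹ * (4 ^ k * k) = k / 144 := by
        field_simp
      rw [this]
      linarith
  have h2 : ∀ k ≥ m + 1, ∀ k' > k, volume.real ((⋃ x ∈ F k, Metric.ball x (ρ / (4 ^ k * k))) ∩
      ⋃ x ∈ F k', Metric.ball x (ρ / (4 ^ k' * k'))) ≤ 300000 * l * (ρ / k * (ρ / k')) := by
    intro k hk k' hkk'
    have hk1 : (1 : ℝ) ≤ k := by exact_mod_cast (by omega : 1 ≤ k)
    have hk1' : (1 : ℝ) ≤ k' := by exact_mod_cast (by omega : 1 ≤ k')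
    have hkk : (k : ℝ) ≤ k' := by exact_mod_cast hkk'.le
    have hp : (4 : ℝ) ^ k ≤ 4 ^ k' := pow_le_pow_right₀ (by norm_num) hkk'.le
    set r := ρ / (4 ^ k * (k : ℝ)) with hrdef
    set s := ρ / (4 ^ k' * (k' : ℝ)) with hsdef
    have hr0 : 0 < r := by positivity
    have hs0 : 0 < s := by positivity
    have hsr : s ≤ r := by rw [hsdef, hrdef]; gcongr
    have hFk : ((F k).card : ℝ) ≤ 145 * l * 4 ^ k := by
      have := card_le_of_separated (F k) id (u := u) (v := v) (s := (144 * 2 ^ (k + k))⁻¹)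
        (by positivity) huv.le (hF k) (fun x hx y hy h => hsep k k x hx y hy (Or.inr h))
      rw [← hl, div_inv_eq_mul, ← two_mul, pow_mul, show (2 : ℝ) ^ 2 = 4 by norm_num] at this
      have := hm k hk
      linarith
    have hcnt : ∀ x ∈ F k, (((F k').filter fun y => |x - y| < r + s).card : ℝ)
        ≤ 864 * r * 4 ^ k' := by
      intro x hx
      rcases ((F k').filter fun y => |x - y| < r + s).eq_empty_or_nonempty with he | ⟨y, hy⟩
      · rw [he]; simp; positivity
      · rw [Finset.mem_filter] at hy
        have h3 := hsep k k' x hx y hy.1 (Or.inl hkk'.ne)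
        have h4 : (144 * 2 ^ (k + k'))⁻¹ ≤ 2 * r := by linarith [hy.2]
        have h5 : 1 ≤ 288 * r * 4 ^ k' := by
          have h6 : (2 : ℝ) ^ (k + k') ≤ 4 ^ k' := by
            rw [show (4 : ℝ) = 2 ^ 2 by norm_num, ← pow_mul]
            exact pow_le_pow_right₀ (by norm_num) (by omega)
          rw [inv_le_iff_one_le_mul₀ (by positivity)] at h4
          nlinarith
        have h7 := card_le_of_separated ((F k').filter fun y => |x - y| < r + s) id
          (u := x - 2 * r) (v := x + 2 * r) (s := (144 * 2 ^ (k' + k'))⁻¹)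
          (by positivity) (by linarith) (fun z hz => by
            have := (abs_lt.1 (Finset.mem_filter.1 hz).2)
            simp only [id]
            constructor <;> linarith)
          (fun z hz w hw h => hsep k' k' z (Finset.mem_filter.1 hz).1 w (Finset.mem_filter.1 hw).1
            (Or.inr h))
        rw [div_inv_eq_mul, ← two_mul, pow_mul, show (2 : ℝ) ^ 2 = 4 by norm_num] at h7
        linarith
    refine (volume_biUnion_ball_inter_le _ _ hs0.le hcnt).trans ?_
    calc ((F k).card : ℝ) * (864 * r * 4 ^ k' * (2 * s))
        ≤ 145 * l * 4 ^ k * (864 * r * 4 ^ k' * (2 * s)) := by gcongr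
      _ = 250560 * l * (ρ / k * (ρ / k')) := by
          rw [hrdef, hsdef]
          field_simp
          norm_num
      _ ≤ _ := by gcongr; norm_num
  have hmain := le_volume_iUnion_of_quasi_independent
    (V := fun k => ⋃ x ∈ F k, Metric.ball x (ρ / (4 ^ k * (k : ℝ))))
    (fun k => Finset.measurableSet_biUnion _ fun x _ => measurableSet_ball)
    (fun k => ((measure_biUnion_finset_le _ _).trans_lt
          (ENNReal.sum_lt_top.2 fun x _ => measure_ball_lt_top)).ne) h1 hl0.le (by norm_num) h2 M
  refine le_trans ?_ hmain
  set t := ∑ k ∈ Finset.Ico (m + 1) M, ρ / (k : ℝ)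
  rw [div_eq_mul_inv]
  refine mul_le_mul_of_nonneg_left ?_ hl0.le
  nlinarith

/-- Reals with a strong reduced rational approximation whose denominator is large and good for
`β` and whose resonance sum is small compared with the quality of the approximation. -/
def goodApprox (β : UnitAddCircle) (δ η : ℝ) (Q : ℕ) : Set ℝ :=
  {α | ∃ q p : ℕ, Q ≤ q ∧ 0 < q ∧ p.Coprime q ∧ δ ≤ ‖q • β‖ ∧ (q : ℝ) ^ 2 * |α - p / q| < η ∧
    ∀ _ : NeZero q, resonance q (p : ZMod q) * ((q : ℝ) ^ 2 * |α - p / q|) ^ 2 < η}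

lemma isOpen_goodApprox (β : UnitAddCircle) (δ η : ℝ) (Q : ℕ) : IsOpen (goodApprox β δ η Q) := by
  have : goodApprox β δ η Q = ⋃ q : ℕ, ⋃ p : ℕ, ⋃ _ : Q ≤ q ∧ p.Coprime q ∧ δ ≤ ‖q • β‖,
      ⋃ h : 0 < q, {α : ℝ | (q : ℝ) ^ 2 * |α - p / q| < η} ∩
        {α : ℝ | (@resonance q ⟨h.ne'⟩ (p : ZMod q)) *
          ((q : ℝ) ^ 2 * |α - p / q|) ^ 2 < η} := by
    ext α
    simp only [goodApprox, mem_iUnion, exists_prop]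
    constructor
    · rintro ⟨q, p, h1, h2, h3, h4, h5, h6⟩
      exact ⟨q, p, ⟨h1, h3, h4⟩, h2, h5, h6 _⟩
    · rintro ⟨q, p, ⟨h1, h3, h4⟩, h2, h5, h6⟩
      exact ⟨q, p, h1, h2, h3, h4, h5, fun _ => h6⟩
  rw [this]
  refine isOpen_iUnion fun q => isOpen_iUnion fun p => isOpen_iUnion fun _ =>
    isOpen_iUnion fun h => IsOpen.inter ?_ ?_
  · exact isOpen_lt (by fun_prop) continuous_const
  · exact isOpen_lt (by fun_prop) continuous_const

lemma inv_le_abs_div_sub_div {p q p' q' : ℕ} (hq : 0 < q) (hq' : 0 < q')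
    (h : (p : ℝ) / q ≠ p' / q') : ((q : ℝ) * q')⁻¹ ≤ |(p : ℝ) / q - p' / q'| := by
  have hq0 : (0 : ℝ) < q := by exact_mod_cast hq
  have hq0' : (0 : ℝ) < q' := by exact_mod_cast hq'
  have e : (p : ℝ) / q - p' / q' = ((p * q' - q * p' : ℤ) : ℝ) / (q * q') := by
    push_cast
    rw [div_sub_div _ _ hq0.ne' hq0'.ne']
  have hne : (p * q' - q * p' : ℤ) ≠ 0 := by
    intro h0
    rw [h0] at e
    apply h
    rw [← sub_eq_zero, e]
    simp
  rw [e, abs_div, abs_of_pos (mul_pos hq0 hq0'), inv_eq_one_div]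
  gcongr
  exact_mod_cast Int.one_le_abs hne

lemma eq_of_div_eq_div_of_coprime {p q p' q' : ℕ} (hq : 0 < q) (hq' : 0 < q')
    (hc : p.Coprime q) (hc' : p'.Coprime q') (h : (p : ℝ) / q = p' / q') : p = p' ∧ q = q' := by
  have hq0 : (q : ℝ) ≠ 0 := by exact_mod_cast hq.ne'
  have hq0' : (q' : ℝ) ≠ 0 := by exact_mod_cast hq'.ne'
  rw [div_eq_div_iff hq0 hq0'] at h
  have h' : p * q' = p' * q := by exact_mod_cast h
  have h1 : q ∣ q' := hc.symm.dvd_of_dvd_mul_left ⟨p', by linarith⟩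
  have h2 : q' ∣ q := hc'.symm.dvd_of_dvd_mul_left ⟨p, by linarith⟩
  have h3 := Nat.dvd_antisymm h1 h2
  subst h3
  exact ⟨Nat.eq_of_mul_eq_mul_right hq h', rfl⟩

lemma le_volume_goodApprox_inter {β : UnitAddCircle} {δ : ℝ}
    (hδ : ∀ m : ℕ, δ ≤ ‖(4 * m + 1) • β‖ ∨ δ ≤ ‖(4 * m + 3) • β‖) {η : ℝ} (hη : 0 < η) (Q : ℕ)
    {u v u' v' : ℝ} (hu : 0 ≤ u) (huv : u < v) (hv : v ≤ 1) (hu' : u' < u) (hv' : v < v') :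
    (v - u) / 600000 ≤ volume.real (goodApprox β δ η Q ∩ Ioo u' v') := by
  classical
  obtain ⟨n₀, hn₀⟩ := le_card_goodFrac hδ hu huv hv
  set l := v - u with hl
  have hl0 : 0 < l := by linarith
  set L := 6 * (1152 / l) with hL
  have hL0 : 0 < L := by positivity
  set F : ℕ → Finset ℝ := fun k =>
    (goodFrac β δ (L * k) u v (2 ^ k)).image fun x => (x.2 : ℝ) / x.1 with hFdef
  have hmem : ∀ k : ℕ, ∀ x ∈ goodFrac β δ (L * k) u v (2 ^ k), (8 * 2 ^ k ≤ x.1 ∧ x.1 < 12 * 2 ^ k) ∧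
      0 < x.1 ∧ δ ≤ ‖x.1 • β‖ ∧ (u * x.1 ≤ x.2 ∧ (x.2 : ℝ) ≤ v * x.1) ∧ x.2.Coprime x.1 ∧
      ∀ _ : NeZero x.1, resonance x.1 (x.2 : ZMod x.1) ≤ (L * k) ^ 2 := by
    intro k x hx
    obtain ⟨h1, h2⟩ := Finset.mem_sigma.1 hx
    obtain ⟨h3, -, h4⟩ := Finset.mem_filter.1 h1
    obtain ⟨h5, h6, h7⟩ := Finset.mem_filter.1 h2
    have h8 := Finset.mem_Ico.1 h3
    refine ⟨h8, ?_, h4, (Finset.mem_filter.1 h5).2, h6, h7⟩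
    have : 0 < 2 ^ k := by positivity
    omega
  have hinj : ∀ k : ℕ, Set.InjOn (fun x : (Σ _ : ℕ, ℕ) => (x.2 : ℝ) / x.1)
      (goodFrac β δ (L * k) u v (2 ^ k)) := by
    intro k x hx y hy hxy
    obtain ⟨-, hx0, -, -, hxc, -⟩ := hmem k x hx
    obtain ⟨-, hy0, -, -, hyc, -⟩ := hmem k y hy
    obtain ⟨h1, h2⟩ := eq_of_div_eq_div_of_coprime hx0 hy0 hxc hyc hxy
    obtain ⟨a, b⟩ := x
    obtain ⟨c, d⟩ := y
    simp only at h1 h2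
    rw [h1, h2]
  have hF : ∀ k, ∀ x ∈ F k, u ≤ x ∧ x ≤ v := by
    intro k x hx
    obtain ⟨y, hy, rfl⟩ := Finset.mem_image.1 hx
    obtain ⟨-, hy0, -, ⟨h1, h2⟩, -⟩ := hmem k y hy
    have hy0' : (0 : ℝ) < y.1 := by exact_mod_cast hy0
    exact ⟨(le_div_iff₀ hy0').2 h1, (div_le_iff₀ hy0').2 h2⟩
  have hsep : ∀ k k', ∀ x ∈ F k, ∀ y ∈ F k', (k ≠ k' ∨ x ≠ y) →
      (144 * 2 ^ (k + k'))⁻¹ ≤ |x - y| := by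
    intro k k' x hx y hy hxy
    obtain ⟨x, hxf, rfl⟩ := Finset.mem_image.1 hx
    obtain ⟨y, hyf, rfl⟩ := Finset.mem_image.1 hy
    obtain ⟨⟨hx1, hx2⟩, hx0, -, -, hxc, -⟩ := hmem k x hxf
    obtain ⟨⟨hy1, hy2⟩, hy0, -, -, hyc, -⟩ := hmem k' y hyf
    have hne : (x.2 : ℝ) / x.1 ≠ y.2 / y.1 := by
      rcases hxy with h | h
      · intro he
        obtain ⟨-, h2⟩ := eq_of_div_eq_div_of_coprime hx0 hy0 hxc hyc he
        rw [h2] at hx1 hx2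
        rcases lt_or_gt_of_ne h with h | h
        · have := Nat.pow_le_pow_right (show 0 < 2 by norm_num) (show k + 1 ≤ k' from h)
          rw [pow_succ] at this
          omega
        · have := Nat.pow_le_pow_right (show 0 < 2 by norm_num) (show k' + 1 ≤ k from h)
          rw [pow_succ] at this
          omega
      · exact h
    refine le_trans ?_ (inv_le_abs_div_sub_div hx0 hy0 hne)
    have hx0' : (0 : ℝ) < x.1 := by exact_mod_cast hx0
    have hy0' : (0 : ℝ) < y.1 := by exact_mod_cast hy0
    refine inv_anti₀ (mul_pos hx0' hy0') ?_
    have hx3 : (x.1 : ℝ) ≤ 12 * 2 ^ k := by exact_mod_cast hx2.le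
    have hy3 : (y.1 : ℝ) ≤ 12 * 2 ^ k' := by exact_mod_cast hy2.le
    calc (x.1 : ℝ) * y.1 ≤ (12 * 2 ^ k) * (12 * 2 ^ k') := by gcongr
      _ = _ := by rw [pow_add]; ring
  obtain ⟨ρ, hρ0, hρ1, hρ2, hρ3⟩ : ∃ ρ : ℝ, 0 < ρ ∧ ρ ≤ 1 / 600000 ∧ 144 * ρ < η ∧
      L ^ 2 * (144 * ρ) ^ 2 < η := by
    have c1 : Tendsto (fun ρ : ℝ => 144 * ρ) (𝓝[>] 0) (𝓝 (144 * 0)) :=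
      (Continuous.tendsto (by fun_prop) _).mono_left nhdsWithin_le_nhds
    have c2 : Tendsto (fun ρ : ℝ => L ^ 2 * (144 * ρ) ^ 2) (𝓝[>] 0) (𝓝 (L ^ 2 * (144 * 0) ^ 2)) :=
      (Continuous.tendsto (by fun_prop) _).mono_left nhdsWithin_le_nhds
    have c3 : ∀ᶠ ρ : ℝ in 𝓝[>] 0, ρ ≤ 1 / 600000 :=
      nhdsWithin_le_nhds (eventually_le_nhds (by norm_num))
    obtain ⟨ρ, h1, h2, h3, h4⟩ := (c3.and ((c1.eventually_lt_const (by simpa using hη)).and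
      ((c2.eventually_lt_const (by simpa using hη)).and self_mem_nhdsWithin))).exists
    exact ⟨ρ, h4, h1, h2, h3⟩
  have hk : ∀ᶠ k : ℕ in atTop, n₀ ≤ 2 ^ k ∧ 1 ≤ l * 4 ^ k ∧ Q ≤ k ∧
      (4 ^ k : ℝ)⁻¹ < u - u' ∧ (4 ^ k : ℝ)⁻¹ < v' - v := by
    have t1 : Tendsto (fun k : ℕ => (4 : ℝ) ^ k) atTop atTop :=
      tendsto_pow_atTop_atTop_of_one_lt (by norm_num)
    have t2 : Tendsto (fun k : ℕ => ((4 : ℝ) ^ k)⁻¹) atTop (𝓝 0) := tendsto_inv_atTop_zero.comp t1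
    refine ((tendsto_pow_atTop_atTop_of_one_lt (show 1 < 2 by norm_num)).eventually_ge_atTop
      n₀).and (((t1.const_mul_atTop hl0).eventually_ge_atTop 1).and
      ((eventually_ge_atTop Q).and ((t2.eventually_lt_const (by linarith)).and
      (t2.eventually_lt_const (by linarith)))))
  obtain ⟨m, hm⟩ := eventually_atTop.1 hk
  obtain ⟨M, hM⟩ := le_volume_iUnion_ball_of_separated (F := F) huv (m := m) hF hsep
    (by
      intro k hkm
      have h1 := hn₀ (2 ^ k) (hm k hkm.le).1 (L * k) (by
        have hk1 : (1 : ℝ) ≤ k := by exact_mod_cast (by omega : 1 ≤ k)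
        have : Real.log (12 * (2 ^ k : ℕ)) ≤ 4 + k := by
          calc Real.log (12 * (2 ^ k : ℕ)) ≤ Real.log (2 ^ (4 + k)) := by
                apply Real.log_le_log (by positivity)
                push_cast
                rw [pow_add]
                gcongr
                norm_num
            _ = ((4 + k : ℕ) : ℝ) * Real.log 2 := Real.log_pow _ _
            _ ≤ ((4 + k : ℕ) : ℝ) * 1 := by
                gcongr
                linarith [Real.log_two_lt_d9]
            _ = 4 + k := by push_cast; ring
        rw [hL, mul_comm 6, mul_assoc]
        gcongr
        linarith)
      rw [Finset.card_image_of_injOn (hinj k)]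
      refine le_trans (le_of_eq ?_) h1
      push_cast
      rw [← pow_mul, mul_comm k 2, pow_mul, ← hl]
      norm_num)
    (fun k hkm => (hm k hkm.le).2.1) hρ0 hρ1
  refine hM.trans (measureReal_mono ?_ ?_)
  · intro α hα
    simp only [mem_iUnion, exists_prop, Metric.mem_ball, Real.dist_eq] at hα
    obtain ⟨k, hkm, x, hx, hxα⟩ := hα
    have hkm' := (Finset.mem_Ico.1 hkm).1
    obtain ⟨-, -, h3, h4, h5⟩ := hm k (by omega)
    have hk1 : (1 : ℝ) ≤ k := by exact_mod_cast (by omega : 1 ≤ k)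
    have hsmall : ρ / (4 ^ k * (k : ℝ)) ≤ (4 ^ k)⁻¹ := by
      rw [div_le_iff₀ (by positivity)]
      have : ((4 : ℝ) ^ k)⁻¹ * (4 ^ k * k) = k := by field_simp
      rw [this]
      linarith
    obtain ⟨hx1, hx2⟩ := hF k x hx
    have habs := abs_lt.1 hxα
    refine ⟨?_, by linarith, by linarith⟩
    obtain ⟨y, hy, rfl⟩ := Finset.mem_image.1 hx
    obtain ⟨⟨hy1, hy2⟩, hy0, hyδ, -, hyc, hyr⟩ := hmem k y hy
    have hy3 : (y.1 : ℝ) ≤ 12 * 2 ^ k := by exact_mod_cast hy2.le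
    have hq2 : (y.1 : ℝ) ^ 2 * |α - y.2 / y.1| ≤ 144 * ρ / k := by
      calc (y.1 : ℝ) ^ 2 * |α - y.2 / y.1| ≤ (12 * 2 ^ k) ^ 2 * (ρ / (4 ^ k * (k : ℝ))) := by
            gcongr
        _ = 144 * ρ / k := by
            rw [mul_pow, ← pow_mul, mul_comm k 2, pow_mul]
            norm_num
            field_simp
    refine ⟨y.1, y.2, ?_, hy0, hyc, hyδ, ?_, ?_⟩
    · have : k < 2 ^ k := Nat.lt_two_pow_self
      omega
    · refine hq2.trans_lt (lt_of_le_of_lt ?_ hρ2)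
      exact div_le_self (by positivity) hk1
    · intro _
      have h0 : 0 ≤ resonance y.1 (y.2 : ZMod y.1) := by
        unfold resonance
        positivity
      calc resonance y.1 (y.2 : ZMod y.1) * ((y.1 : ℝ) ^ 2 * |α - y.2 / y.1|) ^ 2
          ≤ (L * k) ^ 2 * (144 * ρ / k) ^ 2 := by
            gcongr
            exact hyr _
        _ = L ^ 2 * (144 * ρ) ^ 2 := by field_simp
        _ < η := hρ3
  · exact ((measure_mono inter_subset_right).trans_lt measure_Ioo_lt_top).ne

lemma ae_mem_goodApprox {β : UnitAddCircle} {δ : ℝ}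
    (hδ : ∀ m : ℕ, δ ≤ ‖(4 * m + 1) • β‖ ∨ δ ≤ ‖(4 * m + 3) • β‖) {η : ℝ} (hη : 0 < η) (Q : ℕ) :
    ∀ᵐ α ∂(volume.restrict (Ioo (0 : ℝ) 1)), α ∈ goodApprox β δ η Q := by
  rw [ae_restrict_iff' measurableSet_Ioo]
  filter_upwards [Besicovitch.ae_tendsto_measure_inter_div_of_measurableSet volume
    (isOpen_goodApprox β δ η Q).measurableSet] with x hx hx01
  by_contra hnot
  rw [indicator_of_notMem hnot] at hx
  have h1 := hx.eventually_lt_const (u := ENNReal.ofReal (1 / 1200000)) (by simp)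
  have h2 : ∀ᶠ r : ℝ in 𝓝[>] 0, r < x ∧ r < 1 - x :=
    nhdsWithin_le_nhds ((eventually_lt_nhds hx01.1).and
      (eventually_lt_nhds (by linarith [hx01.2])))
  obtain ⟨r, hr, ⟨hr1, hr2⟩, hr0⟩ := (h1.and (h2.and self_mem_nhdsWithin)).exists
  have hr0 : 0 < r := hr0
  have h3 := le_volume_goodApprox_inter hδ hη Q (u := x - r / 2) (v := x + r / 2)
    (u' := x - r) (v' := x + r) (by linarith) (by linarith) (by linarith) (by linarith)
    (by linarith)
  have h4 : volume.real (goodApprox β δ η Q ∩ Ioo (x - r) (x + r))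
      ≤ volume.real (goodApprox β δ η Q ∩ Metric.closedBall x r) := by
    refine measureReal_mono (inter_subset_inter_right _ ?_)
      ((measure_mono inter_subset_right).trans_lt measure_closedBall_lt_top).ne
    rw [Real.closedBall_eq_Icc]
    exact Ioo_subset_Icc_self
  rw [Real.volume_closedBall, ENNReal.div_lt_iff (Or.inl (by simpa using hr0)) (Or.inl ENNReal.ofReal_ne_top),
    ← ENNReal.ofReal_mul (by norm_num)] at hr
  have h5 := (ENNReal.toReal_lt_toReal (hr.trans ENNReal.ofReal_lt_top).ne
    ENNReal.ofReal_ne_top).2 hr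
  rw [ENNReal.toReal_ofReal (by positivity)] at h5
  change volume.real (goodApprox β δ η Q ∩ Metric.closedBall x r) < _ at h5
  linarith

lemma val_add_one_sub_val {q : ℕ} [NeZero q] (w : ZMod q) :
    ((w + 1).val : ℝ) - w.val = 1 - if w = -1 then (q : ℝ) else 0 := by
  have hlt := ZMod.val_lt w
  have h1 : w + 1 = ((w.val + 1 : ℕ) : ZMod q) := by
    push_cast
    rw [ZMod.natCast_zmod_val]
  have h2 : w = -1 ↔ w.val + 1 = q := by
    rw [eq_neg_iff_add_eq_zero, h1, ZMod.natCast_eq_zero_iff]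
    exact ⟨fun h => le_antisymm hlt (Nat.le_of_dvd (by omega) h), fun h => by rw [h]⟩
  rw [h1, ZMod.val_natCast]
  by_cases h : w = -1
  · have h3 := h2.1 h
    rw [if_pos h, h3, Nat.mod_self]
    have : (w.val : ℝ) + 1 = q := by exact_mod_cast h3
    push_cast
    linarith
  · have h3 : w.val + 1 < q := lt_of_le_of_ne hlt fun h4 => h (h2.2 h4)
    rw [if_neg h, Nat.mod_eq_of_lt h3]
    push_cast
    ring

lemma abs_card_residue_sub_le {q : ℕ} [NeZero q] (A : Finset ℕ) (r : ZMod q) {N : ℕ} {lo : ℝ}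
    (hlo : 0 ≤ lo) (h1 : ∀ i ∈ A, i < N ∧ lo ≤ i ∧ (i : ZMod q) = r)
    (h2 : ∀ i : ℕ, i < N → lo < i → (i : ZMod q) = r → i ∈ A) :
    |(A.card : ℝ) - max 0 (N - lo) / q| ≤ 2 := by
  classical
  have hq0 : 0 < q := Nat.pos_of_ne_zero (NeZero.ne q)
  have hq : (0 : ℝ) < q := by exact_mod_cast hq0
  have hr : ∀ i : ℕ, (i : ZMod q) = r ↔ i % q = r.val := by
    intro i
    rw [← ZMod.val_natCast]
    exact (ZMod.val_injective q).eq_iff.symm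
  have hrlt : (r.val : ℝ) ≤ q := by exact_mod_cast (ZMod.val_lt r).le
  have hcard : (A.image fun i => i / q).card = A.card := by
    refine Finset.card_image_of_injOn fun i hi j hj hij => ?_
    have e1 := (hr i).1 (h1 i hi).2.2
    have e2 := (hr j).1 (h1 j hj).2.2
    rw [← Nat.div_add_mod i q, ← Nat.div_add_mod j q, e1, e2]
    exact congrArg (fun k => q * k + r.val) hij
  have hmain := abs_card_sub_le (A.image fun i => i / q) (lo := max 0 ((lo - r.val) / q))
    (hi := (N - r.val) / q) (le_max_left _ _)
    (fun j hj => by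
      obtain ⟨i, hi, rfl⟩ := Finset.mem_image.1 hj
      obtain ⟨h3, h4, h5⟩ := h1 i hi
      have e := Nat.div_add_mod i q
      rw [(hr i).1 h5] at e
      have e' : (q : ℝ) * ((i / q : ℕ) : ℝ) + r.val = i := by exact_mod_cast e
      have h3' : (i : ℝ) ≤ N := by exact_mod_cast h3.le
      refine ⟨max_le (Nat.cast_nonneg _) ?_, ?_⟩
      · rw [div_le_iff₀ hq]
        linarith
      · rw [le_div_iff₀ hq]
        linarith)
    (fun j hj1 hj2 => by
      have h3 := lt_of_le_of_lt (le_max_right _ _) hj1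
      rw [div_lt_iff₀ hq] at h3
      rw [lt_div_iff₀ hq] at hj2
      have h4 : ((q * j + r.val : ℕ) : ℝ) < N := by push_cast; linarith
      refine Finset.mem_image.2 ⟨q * j + r.val, h2 _ (by exact_mod_cast h4) ?_ ?_, ?_⟩
      · push_cast; linarith
      · rw [hr, Nat.mul_add_mod, Nat.mod_eq_of_lt (ZMod.val_lt r)]
      · rw [Nat.mul_add_div hq0, Nat.div_eq_of_lt (ZMod.val_lt r), add_zero])
  rw [hcard] at hmain
  have hdiff : |max 0 (((N : ℝ) - r.val) / q - max 0 ((lo - r.val) / q)) - max 0 (N - lo) / q|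
      ≤ 1 := by
    have e : max 0 ((N : ℝ) - lo) / q = max 0 ((N - lo) / q) := by
      rw [← max_div_div_right hq.le, zero_div]
    rw [e, max_comm, max_comm 0 (((N : ℝ) - lo) / q)]
    refine (abs_max_sub_max_le_abs _ _ _).trans ?_
    have hlast : ((N : ℝ) - r.val) / q - max 0 ((lo - r.val) / q) - (N - lo) / q
      = (lo - r.val) / q - max 0 ((lo - r.val) / q) := by
      field_simp
      ring
    rw [hlast]
    have hge : -1 ≤ (lo - r.val) / q := by
      rw [le_div_iff₀ hq]
      linarith
    rcases max_cases 0 ((lo - r.val) / q) with ⟨h, h'⟩ | ⟨h, h'⟩ <;> rw [h, abs_le] <;>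
      constructor <;> linarith
  calc |(A.card : ℝ) - max 0 (N - lo) / q|
      ≤ _ := abs_sub_le _ (max 0 (((N : ℝ) - r.val) / q - max 0 ((lo - r.val) / q))) _
    _ ≤ 2 := by linarith

/-- The real value of `⌊(Y + i * p) / q⌋`. -/
noncomputable def floorBase (q p : ℕ) (Y : ℤ) (i : ℕ) : ℝ :=
  ((Y : ℝ) + i * p - (((Y : ZMod q) + i * p : ZMod q).val : ℝ)) / q

lemma floor_add_div_eq (q : ℕ) [NeZero q] (y : ℝ) (m : ℤ) :
    ((⌊(y + m) / q⌋ : ℤ) : ℝ) = ((⌊y⌋ : ℝ) + m - (((⌊y⌋ : ZMod q) + m : ZMod q).val : ℝ)) / q := by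
  have hq : (q : ℝ) ≠ 0 := by exact_mod_cast NeZero.ne q
  rw [Int.floor_div_natCast, Int.floor_add_intCast, eq_div_iff hq]
  have h1 := Int.mul_ediv_add_emod (⌊y⌋ + m) q
  rw [← ZMod.val_intCast] at h1
  have h2 : (q : ℝ) * (((⌊y⌋ + m) / (q : ℤ) : ℤ) : ℝ)
      + ((((⌊y⌋ + m : ℤ) : ZMod q).val : ℤ) : ℝ) = ((⌊y⌋ + m : ℤ) : ℝ) := by
    exact_mod_cast h1
  push_cast at h2
  linarith

lemma floorBase_add_one {q p : ℕ} [NeZero q] {p' : ZMod q} (hp : (p : ZMod q) * p' = 1)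
    (Y : ℤ) (i : ℕ) :
    floorBase q p (Y + 1) i
      = floorBase q p Y i + if (i : ZMod q) = -(1 + Y) * p' then 1 else 0 := by
  have hq : (q : ℝ) ≠ 0 := by exact_mod_cast NeZero.ne q
  have h := val_add_one_sub_val ((Y : ZMod q) + (i : ZMod q) * (p : ZMod q))
  have hiff : (Y : ZMod q) + i * p = -1 ↔ (i : ZMod q) = -(1 + Y) * p' := by
    constructor
    · intro h
      linear_combination p' * h - i * hp
    · intro h
      rw [h]
      linear_combination (-(1 + Y) : ZMod q) * hp
  have e : ((Y + 1 : ℤ) : ZMod q) + i * p = (Y + i * p) + 1 := by push_cast; ring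
  rw [floorBase, floorBase, e]
  rw [sub_eq_iff_eq_add] at h
  rw [h]
  simp only [hiff]
  split_ifs <;> push_cast <;> field_simp <;> ring

lemma floor_add_mul_of_pos {q p : ℕ} [NeZero q] {p' : ZMod q} (hp : (p : ZMod q) * p' = 1)
    {ε : ℝ} (hε : 0 < ε) (z : ℝ) {i : ℕ} (hi : (i : ℝ) * (q * ε) < 1) :
    ((⌊z + i * ((p : ℝ) / q + ε)⌋ : ℤ) : ℝ) = floorBase q p ⌊q * z⌋ i +
      if 1 - Int.fract (q * z) ≤ i * (q * ε) ∧ (i : ZMod q) = -(1 + (⌊q * z⌋ : ZMod q)) * p'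
        then 1 else 0 := by
  have hq : (q : ℝ) ≠ 0 := by exact_mod_cast NeZero.ne q
  have e : z + i * ((p : ℝ) / q + ε) = ((q * z + i * (q * ε)) + ((i * p : ℕ) : ℤ)) / q := by
    push_cast
    field_simp
    ring
  have h0 : 0 ≤ (i : ℝ) * (q * ε) := by positivity
  have hf := Int.floor_add_fract (q * z)
  rw [e, floor_add_div_eq]
  by_cases hc : 1 - Int.fract (q * z) ≤ i * (q * ε)
  · have h1 : ⌊q * z + i * (q * ε)⌋ = ⌊q * z⌋ + 1 := by
      rw [Int.floor_eq_iff]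
      push_cast
      have := Int.fract_lt_one (q * z)
      constructor <;> linarith
    rw [h1]
    have h2 := floorBase_add_one hp ⌊q * z⌋ i
    rw [floorBase] at h2
    simp only [hc, true_and]
    rw [← h2]
    push_cast
    rfl
  · have h1 : ⌊q * z + i * (q * ε)⌋ = ⌊q * z⌋ := by
      rw [Int.floor_eq_iff]
      push Not at hc
      have := Int.fract_nonneg (q * z)
      constructor <;> linarith
    rw [h1]
    simp only [hc, false_and, if_false, add_zero, floorBase]
    push_cast
    rfl

lemma floor_add_mul_of_neg {q p : ℕ} [NeZero q] {p' : ZMod q} (hp : (p : ZMod q) * p' = 1)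
    {ε : ℝ} (hε : ε < 0) (z : ℝ) {i : ℕ} (hi : (i : ℝ) * (q * |ε|) < 1) :
    ((⌊z + i * ((p : ℝ) / q + ε)⌋ : ℤ) : ℝ) = floorBase q p ⌊q * z⌋ i -
      if Int.fract (q * z) < i * (q * |ε|) ∧ (i : ZMod q) = -(⌊q * z⌋ : ZMod q) * p'
        then 1 else 0 := by
  have hq : (q : ℝ) ≠ 0 := by exact_mod_cast NeZero.ne q
  have e : z + i * ((p : ℝ) / q + ε) = ((q * z + i * (q * ε)) + ((i * p : ℕ) : ℤ)) / q := by
    push_cast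
    field_simp
    ring
  rw [abs_of_neg hε] at hi ⊢
  have h0 : 0 ≤ (i : ℝ) * (q * -ε) := by
    have : 0 ≤ -ε := by linarith
    positivity
  have hf := Int.floor_add_fract (q * z)
  rw [e, floor_add_div_eq]
  by_cases hc : Int.fract (q * z) < i * (q * -ε)
  · have h1 : ⌊q * z + i * (q * ε)⌋ = ⌊q * z⌋ - 1 := by
      rw [Int.floor_eq_iff]
      push_cast
      have := Int.fract_nonneg (q * z)
      constructor <;> linarith
    rw [h1]
    have h2 := floorBase_add_one hp (⌊q * z⌋ - 1) i
    have h3 : -(1 + ((⌊q * z⌋ - 1 : ℤ) : ZMod q)) * p' = -(⌊q * z⌋ : ZMod q) * p' := by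
      push_cast
      ring
    rw [sub_add_cancel, h3] at h2
    simp only [hc, true_and]
    rw [h2, add_sub_cancel_right, floorBase]
    push_cast
    rfl
  · have h1 : ⌊q * z + i * (q * ε)⌋ = ⌊q * z⌋ := by
      rw [Int.floor_eq_iff]
      push Not at hc
      have := Int.fract_lt_one (q * z)
      constructor <;> linarith
    rw [h1]
    simp only [hc, false_and, if_false, sub_zero, floorBase]
    push_cast
    rfl

lemma abs_sum_floor_sub_le_of_pos {q p : ℕ} [NeZero q] {p' : ZMod q}
    (hp : (p : ZMod q) * p' = 1) {ε : ℝ} (hε : 0 < ε) (z : ℝ) {N : ℕ}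
    (hN : (N : ℝ) * (q * ε) ≤ 1) :
    |∑ i ∈ Finset.range N, ((⌊z + i * ((p : ℝ) / q + ε)⌋ : ℤ) : ℝ)
      - ∑ i ∈ Finset.range N, floorBase q p ⌊q * z⌋ i
      - max 0 (N - (1 - Int.fract (q * z)) / (q * ε)) / q| ≤ 2 := by
  have hq : (0 : ℝ) < q := by exact_mod_cast Nat.pos_of_ne_zero (NeZero.ne q)
  have hqε : 0 < q * ε := by positivity
  rw [Finset.sum_congr rfl fun i hi => floor_add_mul_of_pos hp hε z (i := i) (by
    have : (i : ℝ) < N := by exact_mod_cast Finset.mem_range.1 hi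
    nlinarith), Finset.sum_add_distrib, add_sub_cancel_left, Finset.sum_boole]
  refine abs_card_residue_sub_le _ (-(1 + (⌊q * z⌋ : ZMod q)) * p') ?_ ?_ ?_
  · have := Int.fract_lt_one (q * z)
    exact div_nonneg (by linarith) hqε.le
  · intro i hi
    rw [Finset.mem_filter, Finset.mem_range] at hi
    exact ⟨hi.1, (div_le_iff₀ hqε).2 hi.2.1, hi.2.2⟩
  · intro i h1 h2 h3
    rw [div_lt_iff₀ hqε] at h2
    exact Finset.mem_filter.2 ⟨Finset.mem_range.2 h1, h2.le, h3⟩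

lemma abs_sum_floor_sub_le_of_neg {q p : ℕ} [NeZero q] {p' : ZMod q}
    (hp : (p : ZMod q) * p' = 1) {ε : ℝ} (hε : ε < 0) (z : ℝ) {N : ℕ}
    (hN : (N : ℝ) * (q * |ε|) ≤ 1) :
    |∑ i ∈ Finset.range N, ((⌊z + i * ((p : ℝ) / q + ε)⌋ : ℤ) : ℝ)
      - ∑ i ∈ Finset.range N, floorBase q p ⌊q * z⌋ i
      + max 0 (N - Int.fract (q * z) / (q * |ε|)) / q| ≤ 2 := by
  have hq : (0 : ℝ) < q := by exact_mod_cast Nat.pos_of_ne_zero (NeZero.ne q)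
  have hqε : 0 < q * |ε| := mul_pos hq (abs_pos.2 hε.ne)
  rw [Finset.sum_congr rfl fun i hi => floor_add_mul_of_neg hp hε z (i := i) (by
    have : (i : ℝ) < N := by exact_mod_cast Finset.mem_range.1 hi
    nlinarith), Finset.sum_sub_distrib, sub_sub_cancel_left, Finset.sum_boole, neg_add_eq_sub,
    abs_sub_comm]
  refine abs_card_residue_sub_le _ (-(⌊q * z⌋ : ZMod q) * p') ?_ ?_ ?_
  · exact div_nonneg (Int.fract_nonneg _) hqε.le
  · intro i hi
    rw [Finset.mem_filter, Finset.mem_range] at hi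
    exact ⟨hi.1, (div_le_iff₀ hqε).2 hi.2.1.le, hi.2.2⟩
  · intro i h1 h2 h3
    rw [div_lt_iff₀ hqε] at h2
    exact Finset.mem_filter.2 ⟨Finset.mem_range.2 h1, h2, h3⟩

lemma sum_range_natCast_zmod {q : ℕ} [NeZero q] (h : ZMod q → ℝ) :
    ∑ i ∈ Finset.range q, h (i : ZMod q) = ∑ n, h n := by
  refine Finset.sum_nbij' (fun i => (i : ZMod q)) ZMod.val (fun _ _ => Finset.mem_univ _)
    (fun n _ => Finset.mem_range.2 (ZMod.val_lt n)) (fun i hi => ?_)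
    (fun n _ => ZMod.natCast_zmod_val n) (fun _ _ => rfl)
  exact ZMod.val_cast_of_lt (Finset.mem_range.1 hi)

lemma exists_forall_natCast_eq_sum {q : ℕ} [NeZero q] (g : ZMod q → ℝ) (hg : ∑ n, g n = 0) :
    ∃ u : ZMod q → ℝ, (∀ N : ℕ, u (N : ZMod q) = ∑ i ∈ Finset.range N, g (i : ZMod q)) ∧
      ∀ n, u (n + 1) - u n = g n := by
  have hper : Function.Periodic (fun N : ℕ => ∑ i ∈ Finset.range N, g (i : ZMod q)) q := by
    intro N
    simp only
    rw [Finset.sum_range_add, add_eq_left]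
    simp only [Nat.cast_add]
    rw [sum_range_natCast_zmod (fun n => g ((N : ZMod q) + n)), ← hg]
    exact Equiv.sum_comp (Equiv.addLeft (N : ZMod q)) g
  have hu : ∀ N : ℕ, (fun n : ZMod q => ∑ i ∈ Finset.range n.val, g (i : ZMod q)) (N : ZMod q)
      = ∑ i ∈ Finset.range N, g (i : ZMod q) := by
    intro N
    simp only [ZMod.val_natCast]
    exact hper.map_mod_nat N
  refine ⟨fun n : ZMod q => ∑ i ∈ Finset.range n.val, g (i : ZMod q), hu, fun n => ?_⟩
  have h1 := hu (n.val + 1)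
  have h2 := hu n.val
  rw [Finset.sum_range_succ] at h1
  rw [Nat.cast_add, Nat.cast_one] at h1
  rw [ZMod.natCast_zmod_val] at h1 h2
  rw [h1, h2, add_sub_cancel_left]

lemma card_natCast_eq_le {q : ℕ} [NeZero q] (M : ℕ) (n : ZMod q) :
    (((Finset.Icc 1 M).filter fun N : ℕ => (N : ZMod q) = n).card : ℝ) ≤ M / q + 1 := by
  have hq : (0 : ℝ) < q := by exact_mod_cast Nat.pos_of_ne_zero (NeZero.ne q)
  have := card_le_of_separated ((Finset.Icc 1 M).filter fun N : ℕ => (N : ZMod q) = n)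
    (fun N => (N : ℝ)) (u := 0) (v := M) hq (Nat.cast_nonneg _)
    (fun N hN => by
      have := (Finset.mem_Icc.1 (Finset.mem_filter.1 hN).1).2
      exact ⟨Nat.cast_nonneg _, by exact_mod_cast this⟩)
    (fun N hN N' hN' hne => by
      have h1 : (N : ZMod q) = N' := (Finset.mem_filter.1 hN).2.trans (Finset.mem_filter.1 hN').2.symm
      have h2 : (q : ℤ) ∣ (N : ℤ) - N' := by
        rw [← ZMod.intCast_zmod_eq_zero_iff_dvd]
        push_cast
        rw [h1, sub_self]
      have h3 : (q : ℤ) ≤ |(N : ℤ) - N'| :=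
        Int.le_of_dvd (abs_pos.2 (by omega)) ((dvd_abs _ _).2 h2)
      have : (q : ℝ) ≤ |((N : ℤ) : ℝ) - ((N' : ℤ) : ℝ)| := by exact_mod_cast h3
      simpa using this)
  simpa using this

lemma card_deviation_le {q : ℕ} [NeZero q] (u : ZMod q → ℝ) {c e V : ℝ} (he : 0 < e)
    (hV : ∑ n, (u n - c) ^ 2 ≤ V) (M : ℕ) :
    (((Finset.Icc 1 M).filter fun N : ℕ => e < |u (N : ZMod q) - c|).card : ℝ)
      ≤ (M / q + 1) * (V / e ^ 2) := by
  classical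
  set B := Finset.univ.filter fun n : ZMod q => e < |u n - c| with hB
  have h1 : (B.card : ℝ) * e ^ 2 ≤ V := by
    calc (B.card : ℝ) * e ^ 2 = ∑ n ∈ B, e ^ 2 := by rw [Finset.sum_const, nsmul_eq_mul]
      _ ≤ ∑ n ∈ B, (u n - c) ^ 2 := Finset.sum_le_sum fun n hn => by
          rw [← sq_abs (u n - c)]
          have := (Finset.mem_filter.1 hn).2
          gcongr
      _ ≤ ∑ n, (u n - c) ^ 2 :=
          Finset.sum_le_sum_of_subset_of_nonneg (Finset.subset_univ _) fun _ _ _ => sq_nonneg _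
      _ ≤ V := hV
  have h2 : ((Finset.Icc 1 M).filter fun N : ℕ => e < |u (N : ZMod q) - c|)
      ⊆ B.biUnion fun n => (Finset.Icc 1 M).filter fun N : ℕ => (N : ZMod q) = n := by
    intro N hN
    rw [Finset.mem_filter] at hN
    exact Finset.mem_biUnion.2 ⟨N, Finset.mem_filter.2 ⟨Finset.mem_univ _, hN.2⟩,
      Finset.mem_filter.2 ⟨hN.1, rfl⟩⟩
  have h3 := (Nat.cast_le (α := ℝ)).2 ((Finset.card_le_card h2).trans Finset.card_biUnion_le)
  refine h3.trans ?_
  push_cast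
  calc _ ≤ ∑ n ∈ B, ((M : ℝ) / q + 1) := Finset.sum_le_sum fun n _ => card_natCast_eq_le M n
    _ = (M / q + 1) * B.card := by rw [Finset.sum_const, nsmul_eq_mul, mul_comm]
    _ ≤ _ := by
        gcongr
        rwa [le_div_iff₀ (by positivity)]

/-- The fractional part of the difference between two orbits of a rational rotation. -/
noncomputable def residueGap (q p : ℕ) (Y Z : ℤ) (n : ZMod q) : ℝ :=
  (((Z + n * p : ZMod q).val : ℝ) - ((Y + n * p : ZMod q).val : ℝ)) / q

lemma sum_residueGap {q p : ℕ} [NeZero q] {p' : ZMod q} (hp : (p : ZMod q) * p' = 1) (Y Z : ℤ) :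
    ∑ n, residueGap q p Y Z n = 0 := by
  have h : ∀ W : ℤ, ∑ n : ZMod q, ((W + n * p : ZMod q).val : ℝ) = ∑ n : ZMod q, (n.val : ℝ) := by
    intro W
    let e : ZMod q ≃ ZMod q :=
      { toFun := fun n => W + n * p
        invFun := fun n => (n - W) * p'
        left_inv := fun n => by
          linear_combination n * hp
        right_inv := fun n => by
          linear_combination (n - W) * hp }
    exact Equiv.sum_comp e fun n => (n.val : ℝ)
  simp only [residueGap]
  rw [← Finset.sum_div, Finset.sum_sub_distrib, h, h, sub_self, zero_div]

lemma residueGap_add_sub {q p : ℕ} [NeZero q] {p' : ZMod q} (hp : (p : ZMod q) * p' = 1)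
    (Y Z : ℤ) (n : ZMod q) :
    residueGap q p Y Z (n + p') - residueGap q p Y Z n
      = (if n = -(1 + Y) * p' then 1 else 0) - (if n = -(1 + Z) * p' then 1 else 0) := by
  have hq : (q : ℝ) ≠ 0 := by exact_mod_cast NeZero.ne q
  have hiff : ∀ W : ℤ, (W : ZMod q) + n * p = -1 ↔ n = -(1 + W) * p' := by
    intro W
    constructor
    · intro h
      linear_combination p' * h - n * hp
    · intro h
      rw [h]
      linear_combination (-(1 + W) : ZMod q) * hp
  have he : ∀ W : ℤ, (W : ZMod q) + (n + p') * p = (W + n * p) + 1 := by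
    intro W
    linear_combination hp
  have h1 := val_add_one_sub_val ((Y : ZMod q) + n * (p : ZMod q))
  have h2 := val_add_one_sub_val ((Z : ZMod q) + n * (p : ZMod q))
  rw [sub_eq_iff_eq_add] at h1 h2
  rw [residueGap, residueGap, he, he, h1, h2]
  simp only [hiff]
  split_ifs <;> field_simp <;> ring

lemma exists_variance_bound {q p : ℕ} [NeZero q] {p' : ZMod q} (hp : (p : ZMod q) * p' = 1)
    (Y Z : ℤ) : ∃ (u : ZMod q → ℝ) (c : ℝ),
      (∀ N : ℕ, u (N : ZMod q) = ∑ i ∈ Finset.range N, residueGap q p Y Z (i : ZMod q)) ∧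
      ∑ n, (u n - c) ^ 2 ≤ q * resonance q (p : ZMod q) := by
  obtain ⟨u, hu1, hu2⟩ := exists_forall_natCast_eq_sum _ (sum_residueGap hp Y Z)
  obtain ⟨c, hc⟩ := exists_sum_sub_sq_le hp u _ _ _ hu2 (residueGap_add_sub hp Y Z)
  exact ⟨u, c, hu1, hc⟩

/-- The limiting shape of the Birkhoff sums along a strong rational approximation. -/
noncomputable def shape (τ σ t : ℝ) : ℝ := (τ - σ) * t + max 0 (t - τ) - max 0 (t - σ)

lemma mul_shape (a τ σ t : ℝ) : a * shape τ σ t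
    = a * ((τ - σ) * t) + a * max 0 (t - τ) - a * max 0 (t - σ) := by
  rw [shape]
  ring

/-- Birkhoff sum of a centered interval of length `b`, written with integer parts. -/
noncomputable def floorSum (b x α : ℝ) (N : ℕ) : ℝ :=
  ∑ i ∈ Finset.range N, (((⌊x + i * α⌋ : ℤ) : ℝ) - ((⌊x - b + i * α⌋ : ℤ) : ℝ) - b)

lemma exists_shape_approx {q p : ℕ} [NeZero q] {p' : ZMod q} (hp : (p : ZMod q) * p' = 1)
    {ε : ℝ} (hε : ε ≠ 0) (b x : ℝ) : ∃ τ ∈ Icc (0 : ℝ) 1, ∃ σ ∈ Icc (0 : ℝ) 1,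
      |τ - σ| = |Int.fract (q * (x - b)) - Int.fract (q * x)| ∧
      ∀ N : ℕ, (N : ℝ) * (q * |ε|) ≤ 1 →
        |floorSum b x ((p : ℝ) / q + ε) N
          - (∑ i ∈ Finset.range N, residueGap q p ⌊q * x⌋ ⌊q * (x - b)⌋ (i : ZMod q))
          - 1 / (q ^ 2 * |ε|) * shape τ σ (N * (q * |ε|))| ≤ 4 := by
  have hq : (0 : ℝ) < q := by exact_mod_cast Nat.pos_of_ne_zero (NeZero.ne q)
  have habs : 0 < |ε| := abs_pos.2 hε
  have hsum : ∀ N : ℕ, floorSum b x ((p : ℝ) / q + ε) N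
      - (∑ i ∈ Finset.range N, residueGap q p ⌊q * x⌋ ⌊q * (x - b)⌋ (i : ZMod q))
      = (∑ i ∈ Finset.range N, ((⌊x + i * ((p : ℝ) / q + ε)⌋ : ℤ) : ℝ)
          - ∑ i ∈ Finset.range N, floorBase q p ⌊q * x⌋ i)
        - (∑ i ∈ Finset.range N, ((⌊x - b + i * ((p : ℝ) / q + ε)⌋ : ℤ) : ℝ)
          - ∑ i ∈ Finset.range N, floorBase q p ⌊q * (x - b)⌋ i)
        + N * ((Int.fract (q * (x - b)) - Int.fract (q * x)) / q) := by
    intro N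
    have h1 : N * ((Int.fract (q * (x - b)) - Int.fract (q * x)) / q)
        = ∑ i ∈ Finset.range N, (Int.fract (q * (x - b)) - Int.fract (q * x)) / q := by
      rw [Finset.sum_const, Finset.card_range, nsmul_eq_mul]
    rw [h1, floorSum, ← Finset.sum_sub_distrib, ← Finset.sum_sub_distrib,
      ← Finset.sum_sub_distrib, ← Finset.sum_sub_distrib, ← Finset.sum_add_distrib]
    refine Finset.sum_congr rfl fun i _ => ?_
    rw [residueGap, floorBase, floorBase, ← Int.self_sub_floor, ← Int.self_sub_floor]
    field_simp
    ring
  have hscale : ∀ (N : ℕ) (θ : ℝ), max 0 (N - θ / (q * |ε|)) / q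
      = 1 / (q ^ 2 * |ε|) * max 0 (N * (q * |ε|) - θ) := by
    intro N θ
    rw [← max_div_div_right hq.le, mul_max_of_nonneg _ _ (by positivity)]
    congr 1
    · simp
    · field_simp
  have hlin : ∀ N : ℕ, N * ((Int.fract (q * (x - b)) - Int.fract (q * x)) / q)
      = 1 / (q ^ 2 * |ε|) *
        ((Int.fract (q * (x - b)) - Int.fract (q * x)) * (N * (q * |ε|))) := by
    intro N
    field_simp
  have hx1 := Int.fract_nonneg (q * x)
  have hx2 := (Int.fract_lt_one (q * x)).le
  have hz1 := Int.fract_nonneg (q * (x - b))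
  have hz2 := (Int.fract_lt_one (q * (x - b))).le
  rcases lt_or_gt_of_ne hε with hneg | hpos
  · refine ⟨Int.fract (q * (x - b)), ⟨hz1, hz2⟩, Int.fract (q * x), ⟨hx1, hx2⟩, rfl,
      fun N hN => ?_⟩
    have h1 := abs_le.1 (abs_sum_floor_sub_le_of_neg hp hneg x hN)
    have h2 := abs_le.1 (abs_sum_floor_sub_le_of_neg hp hneg (x - b) hN)
    rw [hscale] at h1 h2
    rw [hsum, hlin, mul_shape, abs_le]
    constructor <;> linarith
  · refine ⟨1 - Int.fract (q * x), ⟨by linarith, by linarith⟩, 1 - Int.fract (q * (x - b)),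
      ⟨by linarith, by linarith⟩, by congr 1; ring, fun N hN => ?_⟩
    rw [abs_of_pos hpos] at hN
    have h1 := abs_le.1 (abs_sum_floor_sub_le_of_pos hp hpos x hN)
    have h2 := abs_le.1 (abs_sum_floor_sub_le_of_pos hp hpos (x - b) hN)
    rw [← abs_of_pos hpos, hscale, abs_of_pos hpos] at h1 h2
    rw [hsum, hlin, mul_shape, abs_le, abs_of_pos hpos, sub_sub_sub_cancel_left]
    constructor <;> linarith

/-- The sequence `S` follows, after affine rescaling and outside a small set of times, a
piecewise linear shape whose breakpoints are well separated. -/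
def HasProfile (S : ℕ → ℝ) (δ : ℝ) (n : ℕ) : Prop :=
  ∃ K a c τ σ : ℝ, n ≤ K ∧ n ≤ a ∧ τ ∈ Icc (0 : ℝ) 1 ∧ σ ∈ Icc (0 : ℝ) 1 ∧
    δ ≤ |τ - σ| ∧ |τ - σ| ≤ 1 - δ ∧
    (((Finset.Icc 1 ⌊K⌋₊).filter fun N : ℕ =>
      a / n < |S N - c - a * shape τ σ (N / K)|).card : ℝ) ≤ K / n

lemma norm_coe_le_abs_fract_sub (y b : ℝ) :
    ‖((b : ℝ) : UnitAddCircle)‖ ≤ |Int.fract (y - b) - Int.fract y| ∧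
      |Int.fract (y - b) - Int.fract y| ≤ 1 - ‖((b : ℝ) : UnitAddCircle)‖ := by
  have hz : ∀ z : ℤ, ‖((b : ℝ) : UnitAddCircle)‖ ≤ |b - z| := fun z => by
    rw [UnitAddCircle.norm_eq]
    exact round_le b z
  have hd : Int.fract (y - b) - Int.fract y = ((⌊y⌋ - ⌊y - b⌋ : ℤ) : ℝ) - b := by
    rw [← Int.self_sub_floor, ← Int.self_sub_floor]
    push_cast
    ring
  have h1 := Int.fract_nonneg (y - b)
  have h2 := Int.fract_lt_one (y - b)
  have h3 := Int.fract_nonneg y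
  have h4 := Int.fract_lt_one y
  refine ⟨?_, ?_⟩
  · rw [hd, abs_sub_comm]
    exact hz _
  · rw [le_sub_comm]
    rcases le_total 0 (Int.fract (y - b) - Int.fract y) with h | h
    · refine (hz (⌊y⌋ - ⌊y - b⌋ - 1)).trans ?_
      have : b - ((⌊y⌋ - ⌊y - b⌋ - 1 : ℤ) : ℝ) = 1 - (Int.fract (y - b) - Int.fract y) := by
        rw [hd]
        push_cast
        ring
      rw [this, abs_of_nonneg h, abs_of_nonneg (by linarith)]
    · refine (hz (⌊y⌋ - ⌊y - b⌋ + 1)).trans ?_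
      have : b - ((⌊y⌋ - ⌊y - b⌋ + 1 : ℤ) : ℝ) = -(1 + (Int.fract (y - b) - Int.fract y)) := by
        rw [hd]
        push_cast
        ring
      rw [this, abs_of_nonpos h, abs_of_nonpos (by linarith)]
      linarith

lemma hasProfile_of_mem_goodApprox {b δ α : ℝ} {n : ℕ} (hn : 0 < n) (hα : Irrational α)
    (h : α ∈ goodApprox (b : UnitAddCircle) δ (1 / (8 * n ^ 3)) n) (x : ℝ) :
    HasProfile (floorSum b x α) δ n := by
  obtain ⟨q, p, hQ, hq, hpq, hδ, hη, hres⟩ := h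
  have : NeZero q := ⟨hq.ne'⟩
  specialize hres this
  have hp : (p : ZMod q) * (p : ZMod q)⁻¹ = 1 := ZMod.coe_mul_inv_eq_one p hpq
  set ε := α - p / q with hεdef
  have hε : ε ≠ 0 := fun h0 => hα ⟨(p : ℚ) / q, by
    push_cast
    linarith⟩
  have hαε : α = (p : ℝ) / q + ε := by rw [hεdef]; ring
  obtain ⟨τ, hτ, σ, hσ, hd, happ⟩ := exists_shape_approx hp hε b x
  obtain ⟨u, c, hu, hV⟩ := exists_variance_bound hp ⌊q * x⌋ ⌊q * (x - b)⌋
  have hq' : (0 : ℝ) < q := by exact_mod_cast hq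
  have hq1 : (1 : ℝ) ≤ q := by exact_mod_cast hq
  have hn' : (1 : ℝ) ≤ n := by exact_mod_cast hn
  have habs : 0 < |ε| := abs_pos.2 hε
  set w := (q : ℝ) ^ 2 * |ε| with hw
  have hw0 : 0 < w := by positivity
  have ha : 8 * (n : ℝ) ^ 3 < 1 / w := by
    rw [lt_div_iff₀ hw0]
    rwa [lt_div_iff₀ (by positivity), mul_comm] at hη
  have hn3 : (n : ℝ) ≤ n ^ 3 := le_self_pow₀ hn' (by norm_num)
  have hKa : 1 / (q * |ε|) = q * (1 / w) := by
    rw [hw]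
    field_simp
  have hK : 0 < 1 / (q * |ε|) := by positivity
  have hbeta : ‖(((q * b : ℝ)) : UnitAddCircle)‖ = ‖q • ((b : ℝ) : UnitAddCircle)‖ := by
    rw [← AddCircle.coe_nsmul, nsmul_eq_mul]
  have hnorm := norm_coe_le_abs_fract_sub (q * x) (q * b)
  rw [hbeta, ← mul_sub, ← hd] at hnorm
  refine ⟨1 / (q * |ε|), 1 / w, c, τ, σ, ?_, by nlinarith, hτ, hσ, hδ.trans hnorm.1,
    hnorm.2.trans (by linarith), ?_⟩
  · rw [hKa]
    nlinarith
  set K := 1 / (q * |ε|) with hKdef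
  set a := 1 / w with hadef
  have ha0 : 0 < a := by positivity
  have he : 0 < a / (2 * n) := by positivity
  have he4 : 4 ≤ a / (2 * n) := by
    rw [le_div_iff₀ (by positivity)]
    nlinarith
  have hsub : ((Finset.Icc 1 ⌊K⌋₊).filter fun N : ℕ =>
      a / n < |floorSum b x α N - c - a * shape τ σ (N / K)|) ⊆
      (Finset.Icc 1 ⌊K⌋₊).filter fun N : ℕ => a / (2 * n) < |u (N : ZMod q) - c| := by
    intro N hN
    rw [Finset.mem_filter] at hN ⊢
    refine ⟨hN.1, ?_⟩
    have hNK : (N : ℝ) ≤ K :=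
      (Nat.cast_le.2 (Finset.mem_Icc.1 hN.1).2).trans (Nat.floor_le hK.le)
    have h1 : (N : ℝ) / K = N * (q * |ε|) := by
      rw [hKdef]
      field_simp
    have h2 : (N : ℝ) * (q * |ε|) ≤ 1 := by
      rw [← h1]
      exact div_le_one_of_le₀ hNK hK.le
    have h3 := happ N h2
    rw [← hαε, ← hu] at h3
    have h4 := hN.2
    rw [h1] at h4
    have h5 : floorSum b x α N - c - a * shape τ σ (N * (q * |ε|))
        = (floorSum b x α N - u N - a * shape τ σ (N * (q * |ε|))) + (u N - c) := by ring
    rw [h5] at h4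
    have h6 := h4.trans_le (abs_add_le _ _)
    have h7 : a / n = a / (2 * n) + a / (2 * n) := by
      field_simp
      ring
    rw [h7] at h6
    linarith
  have hres' : resonance q (p : ZMod q) ≤ 1 / (8 * n ^ 3) * a ^ 2 := by
    rw [hadef, div_pow, one_pow, mul_one_div, le_div_iff₀ (by positivity)]
    exact hres.le
  calc _ ≤ (((Finset.Icc 1 ⌊K⌋₊).filter fun N : ℕ =>
        a / (2 * n) < |u (N : ZMod q) - c|).card : ℝ) := by
        exact_mod_cast Finset.card_le_card hsub
    _ ≤ ((⌊K⌋₊ : ℝ) / q + 1) * (q * resonance q (p : ZMod q) / (a / (2 * n)) ^ 2) :=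
        card_deviation_le u he hV _
    _ ≤ (2 * K / q) * (q * (1 / (8 * n ^ 3) * a ^ 2) / (a / (2 * n)) ^ 2) := by
        have h1 : (⌊K⌋₊ : ℝ) / q + 1 ≤ 2 * K / q := by
          have h2 : (⌊K⌋₊ : ℝ) / q ≤ K / q := by
            gcongr
            exact Nat.floor_le hK.le
          have h3 : 1 ≤ K / q := by
            rw [hKa, mul_div_cancel_left₀ _ hq'.ne']
            nlinarith
          rw [mul_div_assoc]
          linarith
        have h0 : 0 ≤ 2 * K / q := by positivity
        exact mul_le_mul h1 (by gcongr) (by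
          refine div_nonneg ((Finset.sum_nonneg fun _ _ => sq_nonneg _).trans hV) (by positivity)) h0
    _ = K / n := by
        field_simp
        ring

lemma birkhoff_indicator_eq (β : UnitAddCircle) (x α : ℝ) (N : ℕ) :
    ∑ k ∈ Finset.range N, ((if (AddCircle.equivIco (1 : ℝ) 0
      ((x : UnitAddCircle) + k • (α : UnitAddCircle)) : ℝ) < (AddCircle.equivIco (1 : ℝ) 0 β : ℝ)
      then (1 : ℝ) else 0) - (AddCircle.equivIco (1 : ℝ) 0 β : ℝ))
      = floorSum (AddCircle.equivIco (1 : ℝ) 0 β : ℝ) x α N := by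
  obtain ⟨hb0, hb1⟩ := (AddCircle.equivIco (1 : ℝ) 0 β).2
  set b : ℝ := (AddCircle.equivIco (1 : ℝ) 0 β : ℝ)
  rw [zero_add] at hb1
  refine Finset.sum_congr rfl fun k _ => ?_
  have h1 : (x : UnitAddCircle) + k • (α : UnitAddCircle) = ((x + k * α : ℝ) : UnitAddCircle) := by
    rw [← nsmul_eq_mul]
    rfl
  have h2 : (AddCircle.equivIco (1 : ℝ) 0 ((x + k * α : ℝ) : UnitAddCircle) : ℝ)
      = Int.fract (x + k * α) := by
    rw [AddCircle.coe_equivIco_mk_apply]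
    simp
  have h3 : x - b + k * α = (x + k * α) - b := by ring
  rw [h1, h2, h3]
  set y := x + k * α
  have h4 := Int.floor_add_fract y
  congr 1
  split_ifs with h
  · have : ⌊y - b⌋ = ⌊y⌋ - 1 := by
      rw [Int.floor_eq_iff]
      push_cast
      constructor <;> linarith [Int.fract_nonneg y]
    rw [this]
    push_cast
    ring
  · have : ⌊y - b⌋ = ⌊y⌋ := by
      rw [Int.floor_eq_iff]
      constructor <;> linarith [Int.fract_lt_one y]
    rw [this, sub_self]

lemma tendsto_of_tendsto_comp {ι : Type*} {l : Filter ι} {f : ι → ℝ → ℝ} {F : ℝ → ℝ}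
    (hf : ∀ n, Monotone (f n)) (hF : ∀ x, Tendsto (fun n => f n x) l (𝓝 (F x)))
    (hstrict : ∀ x y, x < y → 0 < F y → F x < 1 → F x < F y) {x : ℝ} (h0 : 0 < F x)
    (h1 : F x < 1) {z : ι → ℝ} (hz : Tendsto (fun n => f n (z n)) l (𝓝 (F x))) :
    Tendsto z l (𝓝 x) := by
  have hFmono : Monotone F ∨ l = ⊥ := by
    rcases l.eq_or_neBot with h | h
    · exact Or.inr h
    · exact Or.inl fun a b hab => le_of_tendsto_of_tendsto' (hF a) (hF b) fun n => hf n hab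
  rcases hFmono with hFmono | rfl
  swap
  · exact tendsto_bot
  refine tendsto_order.2 ⟨fun w hw => ?_, fun w hw => ?_⟩
  · have : F w < F x := hstrict w x hw h0 ((hFmono hw.le).trans_lt h1)
    filter_upwards [(hF w).eventually_lt hz this] with n hn
    exact lt_of_not_ge fun h => hn.not_ge (hf n h)
  · have : F x < F w := hstrict x w hw (h0.trans_le (hFmono hw.le)) h1
    filter_upwards [hz.eventually_lt (hF w) this] with n hn
    exact lt_of_not_ge fun h => hn.not_ge (hf n h)

lemma tendsto_comp_of_tendsto {ι : Type*} {l : Filter ι} {f : ι → ℝ → ℝ} {F : ℝ → ℝ}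
    (hf : ∀ n, Monotone (f n)) (hF : ∀ x, Tendsto (fun n => f n x) l (𝓝 (F x)))
    (hcont : Continuous F) {x : ℝ} {z : ι → ℝ} (hz : Tendsto z l (𝓝 x)) :
    Tendsto (fun n => f n (z n)) l (𝓝 (F x)) := by
  refine tendsto_order.2 ⟨fun w hw => ?_, fun w hw => ?_⟩
  · obtain ⟨y, hy, hyx⟩ : ∃ y, w < F y ∧ y < x :=
      (((hcont.tendsto x).mono_left nhdsWithin_le_nhds).eventually (lt_mem_nhds hw)
        |>.and self_mem_nhdsWithin : ∀ᶠ y in 𝓝[<] x, w < F y ∧ y < x).exists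
    filter_upwards [(hF y).eventually (lt_mem_nhds hy), hz.eventually (lt_mem_nhds hyx)]
      with n hn hn'
    exact hn.trans_le (hf n hn'.le)
  · obtain ⟨y, hy, hyx⟩ : ∃ y, F y < w ∧ x < y :=
      (((hcont.tendsto x).mono_left nhdsWithin_le_nhds).eventually (gt_mem_nhds hw)
        |>.and self_mem_nhdsWithin : ∀ᶠ y in 𝓝[>] x, F y < w ∧ x < y).exists
    filter_upwards [(hF y).eventually (gt_mem_nhds hy), hz.eventually (gt_mem_nhds hyx)]
      with n hn hn'
    exact (hf n hn'.le).trans_lt hn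

/-- Convergence of types, for a limit distribution function that is continuous and strictly
increasing on its support. -/
lemma exists_affine_of_tendsto {f : ℕ → ℝ → ℝ} {F H : ℝ → ℝ}
    (hf : ∀ n, Monotone (f n)) (hF : ∀ x, Tendsto (fun n => f n x) atTop (𝓝 (F x)))
    (hcont : Continuous F) (hstrict : ∀ x y, x < y → 0 < F y → F x < 1 → F x < F y)
    {l r : ℝ} (hl : F l = 0) (hr : F r = 1) {A B : ℕ → ℝ} (hB : ∀ n, 0 < B n)
    (hH : ∀ y, Tendsto (fun n => f n (A n + B n * y)) atTop (𝓝 (H y)))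
    {y₁ y₂ : ℝ} (hy : y₁ < y₂) (h₁ : H y₁ ∈ Ioo (0 : ℝ) 1) (h₂ : H y₂ ∈ Ioo (0 : ℝ) 1)
    (htop : Tendsto H atTop (𝓝 1)) :
    ∃ a b : ℝ, 0 < b ∧ ∀ y, H y = F (a + b * y) := by
  have hex : ∀ y, H y ∈ Ioo (0 : ℝ) 1 → ∃ x, Tendsto (fun n => A n + B n * y) atTop (𝓝 x) := by
    intro y hy
    obtain ⟨x, hx⟩ : H y ∈ range F := mem_range_of_exists_le_of_exists_ge hcont
      ⟨l, hl.trans_le hy.1.le⟩ ⟨r, hy.2.le.trans_eq hr.symm⟩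
    have := hH y
    rw [← hx] at this hy
    exact ⟨x, tendsto_of_tendsto_comp hf hF hstrict hy.1 hy.2 this⟩
  obtain ⟨x₁, hx₁⟩ := hex y₁ h₁
  obtain ⟨x₂, hx₂⟩ := hex y₂ h₂
  have hd : 0 < y₂ - y₁ := sub_pos.2 hy
  have hB' : Tendsto B atTop (𝓝 ((x₂ - x₁) / (y₂ - y₁))) := by
    refine ((hx₂.sub hx₁).div_const (y₂ - y₁)).congr fun n => ?_
    field_simp
    ring
  set b := (x₂ - x₁) / (y₂ - y₁)
  have hA' : Tendsto A atTop (𝓝 (x₁ - b * y₁)) := by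
    refine (hx₁.sub (hB'.mul_const y₁)).congr fun n => ?_
    ring
  set a := x₁ - b * y₁
  have hHF : ∀ y, H y = F (a + b * y) := fun y =>
    tendsto_nhds_unique (hH y)
      (tendsto_comp_of_tendsto hf hF hcont (hA'.add (hB'.mul_const y)))
  refine ⟨a, b, lt_of_le_of_ne (ge_of_tendsto' hB' fun n => (hB n).le) fun hb => ?_, hHF⟩
  have hconst : H = fun _ => F a := by
    funext y
    rw [hHF, ← hb, zero_mul, add_zero]
  rw [hconst] at htop h₁
  exact h₁.2.ne (tendsto_nhds_unique tendsto_const_nhds htop)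

/-- The distribution function of the uniform distribution on `[0, 1]`. -/
noncomputable def ramp (u : ℝ) : ℝ := max 0 (min 1 u)

lemma continuous_ramp : Continuous ramp := by
  unfold ramp
  fun_prop

lemma monotone_ramp : Monotone ramp := fun _ _ h => by
  unfold ramp
  gcongr

lemma ramp_nonneg (u : ℝ) : 0 ≤ ramp u := le_max_left _ _

lemma ramp_le_one (u : ℝ) : ramp u ≤ 1 := max_le zero_le_one (min_le_left _ _)

lemma ramp_of_nonpos {u : ℝ} (h : u ≤ 0) : ramp u = 0 :=
  max_eq_left ((min_le_right _ _).trans h)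

lemma ramp_of_one_le {u : ℝ} (h : 1 ≤ u) : ramp u = 1 := by
  rw [ramp, min_eq_left h, max_eq_right zero_le_one]

lemma ramp_of_mem {u : ℝ} (h : u ∈ Icc (0 : ℝ) 1) : ramp u = u := by
  rw [ramp, min_eq_right h.2, max_eq_right h.1]

lemma ramp_pos_iff {u : ℝ} : 0 < ramp u ↔ 0 < u := by
  simp [ramp]

lemma ramp_lt_one_iff {u : ℝ} : ramp u < 1 ↔ u < 1 := by
  simp [ramp]

lemma ramp_lt_ramp {u v : ℝ} (h : u < v) (hv : 0 < v) (hu : u < 1) : ramp u < ramp v := by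
  rw [ramp, ramp, max_lt_iff]
  refine ⟨lt_max_of_lt_right (lt_min one_pos hv), ?_⟩
  rw [min_eq_right hu.le]
  exact lt_max_of_lt_right (lt_min hu h)

/-- Distribution function of a mixture of two uniform distributions, the first one on
`[m₀, m₀ + h₀]` and the second one on `[m₁, m₁ + h₁]`. -/
noncomputable def twoRamps (T₀ T₁ m₀ h₀ m₁ h₁ x : ℝ) : ℝ :=
  (T₀ * ramp ((x - m₀) / h₀) + (T₁ - T₀) * ramp ((x - m₁) / h₁)) / T₁

section twoRamps

variable {T₀ T₁ m₀ h₀ m₁ h₁ : ℝ}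

lemma continuous_twoRamps : Continuous (twoRamps T₀ T₁ m₀ h₀ m₁ h₁) := by
  have := continuous_ramp
  unfold twoRamps
  fun_prop

lemma twoRamps_eq_zero (hh₁ : 0 < h₁) (hm : m₀ ≤ m₁) :
    twoRamps T₀ T₁ m₀ h₀ m₁ h₁ m₀ = 0 := by
  rw [twoRamps, ramp_of_nonpos (by simp), ramp_of_nonpos
    (div_nonpos_of_nonpos_of_nonneg (by linarith) hh₁.le)]
  simp

lemma twoRamps_eq_one (hT₁ : 0 < T₁) (hh₀ : 0 < h₀) (hh₁ : 0 < h₁)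
    (hm' : m₁ + h₁ ≤ m₀ + h₀) : twoRamps T₀ T₁ m₀ h₀ m₁ h₁ (m₀ + h₀) = 1 := by
  rw [twoRamps, ramp_of_one_le (by rw [le_div_iff₀ hh₀]; linarith), ramp_of_one_le
    (by rw [le_div_iff₀ hh₁]; linarith)]
  field_simp
  ring

lemma twoRamps_pos (hT₀ : 0 < T₀) (hT : T₀ ≤ T₁) (hh₀ : 0 < h₀) {x : ℝ} (hx : m₀ < x) :
    0 < twoRamps T₀ T₁ m₀ h₀ m₁ h₁ x := by
  have h1 : 0 < ramp ((x - m₀) / h₀) := ramp_pos_iff.2 (div_pos (by linarith) hh₀)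
  have h2 := ramp_nonneg ((x - m₁) / h₁)
  have h3 : 0 ≤ T₁ - T₀ := by linarith
  exact div_pos (by positivity) (by linarith)

lemma twoRamps_lt_one (hT₀ : 0 < T₀) (hT : T₀ ≤ T₁) (hh₀ : 0 < h₀) {x : ℝ} (hx : x < m₀ + h₀) :
    twoRamps T₀ T₁ m₀ h₀ m₁ h₁ x < 1 := by
  have h1 : ramp ((x - m₀) / h₀) < 1 :=
    ramp_lt_one_iff.2 (by rw [div_lt_one hh₀]; linarith)
  have h2 := ramp_le_one ((x - m₁) / h₁)
  rw [twoRamps, div_lt_one (by linarith)]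
  nlinarith

lemma twoRamps_strict (hT₀ : 0 < T₀) (hT : T₀ ≤ T₁) (hh₀ : 0 < h₀) (hh₁ : 0 < h₁)
    (hm : m₀ ≤ m₁) (hm' : m₁ + h₁ ≤ m₀ + h₀) (x y : ℝ) (hxy : x < y)
    (hy : 0 < twoRamps T₀ T₁ m₀ h₀ m₁ h₁ y) (hx : twoRamps T₀ T₁ m₀ h₀ m₁ h₁ x < 1) :
    twoRamps T₀ T₁ m₀ h₀ m₁ h₁ x < twoRamps T₀ T₁ m₀ h₀ m₁ h₁ y := by
  have hT₁ : 0 < T₁ := hT₀.trans_le hT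
  have hTd : 0 ≤ T₁ - T₀ := by linarith
  have hmono : Monotone (twoRamps T₀ T₁ m₀ h₀ m₁ h₁) := fun u v huv => by
    have := @monotone_ramp
    unfold twoRamps
    gcongr ?_ / _
    exact add_le_add (mul_le_mul_of_nonneg_left (this (by gcongr)) hT₀.le)
      (mul_le_mul_of_nonneg_left (this (by gcongr)) hTd)
  have hy' : m₀ < y := lt_of_not_ge fun h => by
    have := hmono h
    rw [twoRamps_eq_zero hh₁ hm] at this
    linarith
  have hx' : x < m₀ + h₀ := lt_of_not_ge fun h => by
    have := hmono h
    rw [twoRamps_eq_one hT₁ hh₀ hh₁ hm'] at this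
    linarith
  have h1 : ramp ((x - m₀) / h₀) < ramp ((y - m₀) / h₀) :=
    ramp_lt_ramp (by gcongr) (div_pos (by linarith) hh₀) (by rw [div_lt_one hh₀]; linarith)
  have h2 : ramp ((x - m₁) / h₁) ≤ ramp ((y - m₁) / h₁) := monotone_ramp (by gcongr)
  unfold twoRamps
  gcongr ?_ / _
  exact add_lt_add_of_lt_of_le (mul_lt_mul_of_pos_left h1 hT₀)
    (mul_le_mul_of_nonneg_left h2 hTd)

lemma false_of_twoRamps_eq_ramp (hT₀ : 0 < T₀) (hT : T₀ < T₁) (hh₀ : 0 < h₀) (hh₁ : 0 < h₁)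
    (hm : m₀ ≤ m₁) (hm' : m₁ + h₁ ≤ m₀ + h₀) (hh : h₁ < h₀) {a b : ℝ}
    (h : ∀ x, twoRamps T₀ T₁ m₀ h₀ m₁ h₁ x = ramp (a + b * x)) : False := by
  have hT₁ : 0 < T₁ := hT₀.trans hT
  have hc : Continuous fun x : ℝ => a + b * x := by fun_prop
  have hin : ∀ x ∈ Icc m₀ (m₀ + h₀), twoRamps T₀ T₁ m₀ h₀ m₁ h₁ x = a + b * x := by
    have hcl : IsClosed {x | twoRamps T₀ T₁ m₀ h₀ m₁ h₁ x = a + b * x} :=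
      isClosed_eq continuous_twoRamps hc
    have hsub : Ioo m₀ (m₀ + h₀) ⊆ {x | twoRamps T₀ T₁ m₀ h₀ m₁ h₁ x = a + b * x} := by
      intro x hx
      have h1 := twoRamps_pos (m₁ := m₁) (h₁ := h₁) hT₀ hT.le hh₀ hx.1
      have h2 := twoRamps_lt_one (m₁ := m₁) (h₁ := h₁) hT₀ hT.le hh₀ hx.2
      rw [h] at h1 h2
      rw [mem_ofPred_eq, h, ramp_of_mem ⟨(ramp_pos_iff.1 h1).le, (ramp_lt_one_iff.1 h2).le⟩]
    have := hcl.closure_subset_iff.2 hsub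
    rwa [closure_Ioo (by linarith)] at this
  have e0 := hin m₀ ⟨le_rfl, by linarith⟩
  have e1 := hin (m₀ + h₀) ⟨by linarith, le_rfl⟩
  rw [twoRamps_eq_zero hh₁ hm] at e0
  rw [twoRamps_eq_one hT₁ hh₀ hh₁ hm'] at e1
  have key : ∀ x ∈ Icc m₀ (m₀ + h₀), ramp ((x - m₁) / h₁) = (x - m₀) / h₀ := by
    intro x hx
    have h1 := hin x hx
    have h2 : a + b * x = (x - m₀) / h₀ := by
      rw [eq_div_iff hh₀.ne']
      have hb : b * h₀ = 1 := by linarith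
      have ha : a = -b * m₀ := by linarith
      rw [ha]
      linear_combination (x - m₀) * hb
    rw [h2, twoRamps, ramp_of_mem ⟨div_nonneg (by linarith [hx.1]) hh₀.le,
      (div_le_one hh₀).2 (by linarith [hx.2])⟩, div_eq_iff hT₁.ne'] at h1
    have h3 : (T₁ - T₀) * ramp ((x - m₁) / h₁) = (T₁ - T₀) * ((x - m₀) / h₀) := by linarith
    exact mul_left_cancel₀ (sub_pos.2 hT).ne' h3
  have k0 := key m₁ ⟨hm, by linarith⟩
  have k1 := key (m₁ + h₁) ⟨by linarith, hm'⟩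
  rw [ramp_of_nonpos (by simp), eq_comm, div_eq_iff hh₀.ne'] at k0
  rw [ramp_of_one_le (by rw [le_div_iff₀ hh₁]; linarith), eq_comm, div_eq_iff hh₀.ne'] at k1
  linarith

end twoRamps

lemma mul_ramp_div {d : ℝ} (hd : 0 < d) (u : ℝ) : d * ramp (u / d) = max 0 (min d u) := by
  rw [ramp, mul_max_of_nonneg _ _ hd.le, mul_min_of_nonneg _ _ hd.le, mul_zero, mul_one,
    mul_div_cancel₀ _ hd.ne']

lemma abs_card_linear_sub_le {t₀ t₁ K v s : ℝ} (ht₀ : 0 ≤ t₀) (ht : t₀ < t₁) (hK : 0 < K)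
    (hs : s ≠ 0) (x : ℝ) :
    |(((Finset.Ioc ⌊t₀ * K⌋₊ ⌊t₁ * K⌋₊).filter fun N : ℕ => v + s * (N / K - t₀) ≤ x).card : ℝ)
      - K * ((t₁ - t₀) * ramp ((x - (v + min 0 (s * (t₁ - t₀)))) / (|s| * (t₁ - t₀))))| ≤ 1 := by
  have hd : 0 < t₁ - t₀ := sub_pos.2 ht
  have ht₁ : 0 ≤ t₁ := ht₀.trans ht.le
  have hmem : ∀ N : ℕ, N ∈ Finset.Ioc ⌊t₀ * K⌋₊ ⌊t₁ * K⌋₊ ↔ t₀ * K < N ∧ (N : ℝ) ≤ t₁ * K :=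
    fun N => by
      rw [Finset.mem_Ioc, Nat.floor_lt (by positivity), Nat.le_floor_iff (by positivity)]
  rcases lt_or_gt_of_ne hs with hneg | hpos
  · have h1 : (x - (v + min 0 (s * (t₁ - t₀)))) / (|s| * (t₁ - t₀))
        = (t₁ - t₀ - (x - v) / s) / (t₁ - t₀) := by
      rw [min_eq_right (by nlinarith), abs_of_neg hneg]
      field_simp
      ring
    have h2 : K * max 0 (min (t₁ - t₀) (t₁ - t₀ - (x - v) / s))
        = max 0 (t₁ * K - max (t₀ * K) ((t₀ + (x - v) / s) * K)) := by
      rw [mul_max_of_nonneg _ _ hK.le, mul_min_of_nonneg _ _ hK.le, mul_zero,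
        ← min_sub_sub_left]
      congr 2 <;> ring
    rw [h1, mul_ramp_div hd, h2]
    have hiff : ∀ N : ℕ, v + s * (N / K - t₀) ≤ x ↔ (t₀ + (x - v) / s) * K ≤ N := fun N => by
      rw [← le_div_iff₀ hK, ← le_sub_iff_add_le', ← le_sub_iff_add_le', div_le_iff_of_neg hneg,
        mul_comm]
    refine abs_card_sub_le _ (le_max_of_le_left (by positivity)) (fun N hN => ?_)
      (fun N h h' => ?_)
    · rw [Finset.mem_filter, hmem, hiff] at hN
      exact ⟨max_le hN.1.1.le hN.2, hN.1.2⟩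
    · rw [Finset.mem_filter, hmem, hiff]
      rw [max_lt_iff] at h
      exact ⟨⟨h.1, h'.le⟩, h.2.le⟩
  · have h1 : (x - (v + min 0 (s * (t₁ - t₀)))) / (|s| * (t₁ - t₀))
        = ((x - v) / s) / (t₁ - t₀) := by
      rw [min_eq_left (by positivity), abs_of_pos hpos]
      field_simp
      ring
    have h2 : K * max 0 (min (t₁ - t₀) ((x - v) / s))
        = max 0 (min (t₁ * K) ((t₀ + (x - v) / s) * K) - t₀ * K) := by
      rw [mul_max_of_nonneg _ _ hK.le, mul_min_of_nonneg _ _ hK.le, mul_zero,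
        ← min_sub_sub_right]
      congr 2 <;> ring
    rw [h1, mul_ramp_div hd, h2]
    have hiff : ∀ N : ℕ, v + s * (N / K - t₀) ≤ x ↔ N ≤ (t₀ + (x - v) / s) * K := fun N => by
      rw [← div_le_iff₀ hK, ← sub_le_iff_le_add', ← le_sub_iff_add_le', le_div_iff₀ hpos,
        mul_comm]
    refine abs_card_sub_le _ (by positivity) (fun N hN => ?_) (fun N h h' => ?_)
    · rw [Finset.mem_filter, hmem, hiff] at hN
      exact ⟨hN.1.1.le, le_min hN.1.2 hN.2⟩
    · rw [Finset.mem_filter, hmem, hiff]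
      rw [lt_min_iff] at h'
      exact ⟨⟨h, h'.1.le⟩, h'.2.le⟩

lemma tendsto_empirical {S : ℕ → ℝ} {K a c r η : ℕ → ℝ} {g Φ : ℝ → ℝ} {T : ℝ} (hT : 0 < T)
    (hT1 : T ≤ 1) (hK : Tendsto K atTop atTop) (hK0 : ∀ n, 0 < K n)
    (hr : Tendsto r atTop (𝓝 0)) (hη : Tendsto η atTop (𝓝 0))
    (hbad : ∀ n, (((Finset.Icc 1 ⌊K n⌋₊).filter fun N : ℕ =>
      r n < |(S N - c n) / a n - g (N / K n)|).card : ℝ) ≤ K n * η n)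
    (hΦ : Continuous Φ)
    (hcount : ∀ n x, |(((Finset.Icc 1 ⌊T * K n⌋₊).filter fun N : ℕ => g (N / K n) ≤ x).card : ℝ)
      - K n * (T * Φ x)| ≤ 2) (x : ℝ) :
    Tendsto (fun n => (((Finset.Icc 1 ⌊T * K n⌋₊).filter fun N : ℕ =>
      (S N - c n) / a n ≤ x).card : ℝ) / ⌊T * K n⌋₊) atTop (𝓝 (Φ x)) := by
  have hfl : ∀ n, ⌊T * K n⌋₊ ≤ ⌊K n⌋₊ := fun n =>
    Nat.floor_le_floor (mul_le_of_le_one_left (hK0 n).le hT1)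
  have hup : ∀ n, (((Finset.Icc 1 ⌊T * K n⌋₊).filter fun N : ℕ =>
      (S N - c n) / a n ≤ x).card : ℝ) ≤ K n * (T * Φ (x + r n) + 2 / K n + η n) := by
    intro n
    have hsub : ((Finset.Icc 1 ⌊T * K n⌋₊).filter fun N : ℕ => (S N - c n) / a n ≤ x) ⊆
        ((Finset.Icc 1 ⌊T * K n⌋₊).filter fun N : ℕ => g (N / K n) ≤ x + r n) ∪
        ((Finset.Icc 1 ⌊K n⌋₊).filter fun N : ℕ =>
          r n < |(S N - c n) / a n - g (N / K n)|) := by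
      intro N hN
      simp only [Finset.mem_union, Finset.mem_filter, Finset.mem_Icc] at hN ⊢
      by_cases h : r n < |(S N - c n) / a n - g (N / K n)|
      · exact Or.inr ⟨⟨hN.1.1, hN.1.2.trans (hfl n)⟩, h⟩
      · refine Or.inl ⟨hN.1, ?_⟩
        have := (abs_le.1 (not_lt.1 h)).1
        linarith [hN.2]
    have h1 : (_ : ℝ) ≤ _ :=
      Nat.cast_le.2 ((Finset.card_le_card hsub).trans (Finset.card_union_le _ _))
    push_cast at h1
    have h2 := (abs_le.1 (hcount n (x + r n))).2
    have h3 := hbad n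
    have h4 : K n * (2 / K n) = 2 := mul_div_cancel₀ _ (hK0 n).ne'
    linarith
  have hlow : ∀ n, K n * (T * Φ (x - r n) - 2 / K n - η n) ≤
      (((Finset.Icc 1 ⌊T * K n⌋₊).filter fun N : ℕ => (S N - c n) / a n ≤ x).card : ℝ) := by
    intro n
    have hsub : ((Finset.Icc 1 ⌊T * K n⌋₊).filter fun N : ℕ => g (N / K n) ≤ x - r n) ⊆
        ((Finset.Icc 1 ⌊T * K n⌋₊).filter fun N : ℕ => (S N - c n) / a n ≤ x) ∪
        ((Finset.Icc 1 ⌊K n⌋₊).filter fun N : ℕ =>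
          r n < |(S N - c n) / a n - g (N / K n)|) := by
      intro N hN
      simp only [Finset.mem_union, Finset.mem_filter, Finset.mem_Icc] at hN ⊢
      by_cases h : r n < |(S N - c n) / a n - g (N / K n)|
      · exact Or.inr ⟨⟨hN.1.1, hN.1.2.trans (hfl n)⟩, h⟩
      · refine Or.inl ⟨hN.1, ?_⟩
        have := (abs_le.1 (not_lt.1 h)).2
        linarith [hN.2]
    have h1 : (_ : ℝ) ≤ _ :=
      Nat.cast_le.2 ((Finset.card_le_card hsub).trans (Finset.card_union_le _ _))
    push_cast at h1
    have h2 := (abs_le.1 (hcount n (x - r n))).1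
    have h3 := hbad n
    have h4 : K n * (2 / K n) = 2 := mul_div_cancel₀ _ (hK0 n).ne'
    linarith
  have hM : Tendsto (fun n => (⌊T * K n⌋₊ : ℝ) / K n) atTop (𝓝 T) :=
    (tendsto_nat_floor_mul_div_atTop hT.le).comp hK
  have h2K : Tendsto (fun n => 2 / K n) atTop (𝓝 0) := hK.const_div_atTop 2
  have hlimU : Tendsto (fun n => (T * Φ (x + r n) + 2 / K n + η n) / (⌊T * K n⌋₊ / K n)) atTop
      (𝓝 (Φ x)) := by
    have h1 : Tendsto (fun n => Φ (x + r n)) atTop (𝓝 (Φ x)) :=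
      (hΦ.tendsto x).comp (by simpa using hr.const_add x)
    have := ((((h1.const_mul T).add h2K).add hη).div hM hT.ne')
    rw [show (T * Φ x + 0 + 0) / T = Φ x by field_simp; simp] at this
    exact this
  have hlimL : Tendsto (fun n => (T * Φ (x - r n) - 2 / K n - η n) / (⌊T * K n⌋₊ / K n)) atTop
      (𝓝 (Φ x)) := by
    have h1 : Tendsto (fun n => Φ (x - r n)) atTop (𝓝 (Φ x)) :=
      (hΦ.tendsto x).comp (by simpa using hr.const_sub x)
    have := ((((h1.const_mul T).sub h2K).sub hη).div hM hT.ne')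
    rw [show (T * Φ x - 0 - 0) / T = Φ x by field_simp; simp] at this
    exact this
  have e : ∀ (n : ℕ) (y : ℝ), y / ((⌊T * K n⌋₊ : ℝ) / K n) = K n * y / ⌊T * K n⌋₊ := fun n y => by
    rw [div_div_eq_mul_div, mul_comm]
  refine tendsto_of_tendsto_of_tendsto_of_le_of_le hlimL hlimU (fun n => ?_) (fun n => ?_)
  · simp only [e]
    gcongr
    exact hlow n
  · simp only [e]
    gcongr
    exact hup n

/-- On `[0, T₁]` the function `g` is linear with slope `s` up to time `T₀` and then folds back
with slope `s'`, not reaching its initial value. -/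
structure FoldsBack (g : ℝ → ℝ) (T₀ T₁ s s' : ℝ) : Prop where
  pos : 0 < T₀
  lt : T₀ < T₁
  le_one : T₁ ≤ 1
  mul_neg : s * s' < 0
  short : |s'| * (T₁ - T₀) < |s| * T₀
  left : ∀ t ∈ Icc 0 T₀, g t = s * t
  right : ∀ t ∈ Icc T₀ T₁, g t = s * T₀ + s' * (t - T₀)

lemma exists_foldsBack_of_slopes {g : ℝ → ℝ} {T₀ T₁ s s' : ℝ} (h0 : 0 < T₀) (h1 : T₀ < T₁)
    (h2 : T₁ ≤ 1) (hs : s * s' < 0) (hleft : ∀ t ∈ Icc 0 T₀, g t = s * t)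
    (hright : ∀ t ∈ Icc T₀ T₁, g t = s * T₀ + s' * (t - T₀)) :
    ∃ T₁ : ℝ, FoldsBack g T₀ T₁ s s' := by
  have hs0 : 0 < |s| := abs_pos.2 (left_ne_zero_of_mul hs.ne)
  have hs1 : 0 < |s'| := abs_pos.2 (right_ne_zero_of_mul hs.ne)
  have hpos : 0 < |s| * T₀ / (2 * |s'|) := by positivity
  refine ⟨min T₁ (T₀ + |s| * T₀ / (2 * |s'|)), h0, lt_min h1 (by linarith),
    (min_le_left _ _).trans h2, hs, ?_, hleft,
    fun t ht => hright t ⟨ht.1, ht.2.trans (min_le_left _ _)⟩⟩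
  have h3 := min_le_right T₁ (T₀ + |s| * T₀ / (2 * |s'|))
  calc |s'| * (min T₁ (T₀ + |s| * T₀ / (2 * |s'|)) - T₀)
      ≤ |s'| * (|s| * T₀ / (2 * |s'|)) := by
        gcongr
        linarith
    _ = |s| * T₀ / 2 := by field_simp
    _ < |s| * T₀ := half_lt_self (by positivity)

lemma shape_swap (τ σ t : ℝ) : shape σ τ t = -shape τ σ t := by
  unfold shape
  ring

lemma exists_foldsBack_shape_of_lt {τ σ : ℝ} (hτ : 0 ≤ τ) (hσ : σ ≤ 1) (h : τ < σ)
    (hd : σ - τ < 1) : ∃ T₀ T₁ s s' : ℝ, FoldsBack (shape τ σ) T₀ T₁ s s' := by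
  rcases hτ.eq_or_lt with rfl | hτ
  · obtain ⟨T₁, hT⟩ := exists_foldsBack_of_slopes (g := shape 0 σ) (T₀ := σ) (T₁ := 1)
      (s := 1 - σ) (s' := -σ) h (by linarith) le_rfl (by nlinarith)
      (fun t ht => by
        rw [shape, max_eq_right (by linarith [ht.1]), max_eq_left (by linarith [ht.2])]
        ring)
      (fun t ht => by
        rw [shape, max_eq_right (by linarith [ht.1]), max_eq_right (by linarith [ht.1])]
        ring)
    exact ⟨_, _, _, _, hT⟩
  · obtain ⟨T₁, hT⟩ := exists_foldsBack_of_slopes (g := shape τ σ) (T₀ := τ) (T₁ := σ)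
      (s := τ - σ) (s' := 1 - (σ - τ)) hτ h hσ (by nlinarith)
      (fun t ht => by
        rw [shape, max_eq_left (by linarith [ht.2]), max_eq_left (by linarith [ht.2])]
        ring)
      (fun t ht => by
        rw [shape, max_eq_right (by linarith [ht.1]), max_eq_left (by linarith [ht.2])]
        ring)
    exact ⟨_, _, _, _, hT⟩

lemma exists_foldsBack_shape {τ σ : ℝ} (hτ : τ ∈ Icc (0 : ℝ) 1) (hσ : σ ∈ Icc (0 : ℝ) 1)
    (h : 0 < |τ - σ|) (hd : |τ - σ| < 1) :
    ∃ T₀ T₁ s s' : ℝ, FoldsBack (shape τ σ) T₀ T₁ s s' := by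
  rw [abs_lt] at hd
  rcases lt_or_gt_of_ne (sub_ne_zero.1 (abs_pos.1 h)) with hlt | hlt
  · exact exists_foldsBack_shape_of_lt hτ.1 hσ.2 hlt (by linarith)
  · obtain ⟨T₀, T₁, s, s', hT⟩ := exists_foldsBack_shape_of_lt hσ.1 hτ.2 hlt (by linarith)
    refine ⟨T₀, T₁, -s, -s', hT.pos, hT.lt, hT.le_one, by rw [neg_mul_neg]; exact hT.mul_neg,
      by rw [abs_neg, abs_neg]; exact hT.short, fun t ht => ?_, fun t ht => ?_⟩
    · rw [shape_swap, hT.left t ht, neg_mul]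
    · rw [shape_swap, hT.right t ht]
      ring

/-- The limiting distribution function of `g` on `[0, T₁]`, for a function that folds back. -/
noncomputable def foldCdf (T₀ T₁ s s' : ℝ) : ℝ → ℝ :=
  twoRamps T₀ T₁ (min 0 (s * T₀)) (|s| * T₀) (s * T₀ + min 0 (s' * (T₁ - T₀)))
    (|s'| * (T₁ - T₀))

namespace FoldsBack

variable {g : ℝ → ℝ} {T₀ T₁ s s' : ℝ}

lemma left_ne_zero (h : FoldsBack g T₀ T₁ s s') : s ≠ 0 := left_ne_zero_of_mul h.mul_neg.ne

lemma right_ne_zero (h : FoldsBack g T₀ T₁ s s') : s' ≠ 0 := right_ne_zero_of_mul h.mul_neg.ne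

lemma nested (h : FoldsBack g T₀ T₁ s s') :
    min 0 (s * T₀) ≤ s * T₀ + min 0 (s' * (T₁ - T₀)) ∧
      s * T₀ + min 0 (s' * (T₁ - T₀)) + |s'| * (T₁ - T₀) ≤ min 0 (s * T₀) + |s| * T₀ := by
  have h0 := h.pos
  have h1 := sub_pos.2 h.lt
  have h2 := h.short
  rcases mul_neg_iff.1 h.mul_neg with ⟨hs, hs'⟩ | ⟨hs, hs'⟩
  · have e1 : 0 < s * T₀ := by positivity
    have e2 : s' * (T₁ - T₀) < 0 := mul_neg_of_neg_of_pos hs' h1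
    rw [abs_of_pos hs, abs_of_neg hs'] at *
    rw [min_eq_left e1.le, min_eq_right e2.le]
    constructor <;> linarith
  · have e1 : s * T₀ < 0 := mul_neg_of_neg_of_pos hs h0
    have e2 : 0 < s' * (T₁ - T₀) := by positivity
    rw [abs_of_neg hs, abs_of_pos hs'] at *
    rw [min_eq_right e1.le, min_eq_left e2.le]
    constructor <;> linarith

lemma abs_card_left_sub_le (h : FoldsBack g T₀ T₁ s s') {K : ℝ} (hK : 0 < K) (x : ℝ) :
    |(((Finset.Ioc 0 ⌊T₀ * K⌋₊).filter fun N : ℕ => g (N / K) ≤ x).card : ℝ)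
      - K * (T₀ * ramp ((x - min 0 (s * T₀)) / (|s| * T₀)))| ≤ 1 := by
  have := abs_card_linear_sub_le (v := 0) le_rfl h.pos hK h.left_ne_zero x
  simp only [zero_mul, Nat.floor_zero, sub_zero, zero_add] at this
  refine le_of_eq_of_le ?_ this
  congr 4
  refine Finset.filter_congr fun N hN => ?_
  rw [h.left]
  refine ⟨by positivity, ?_⟩
  rw [div_le_iff₀ hK]
  exact (Nat.le_floor_iff (mul_nonneg h.pos.le hK.le)).1 (Finset.mem_Ioc.1 hN).2

lemma abs_card_right_sub_le (h : FoldsBack g T₀ T₁ s s') {K : ℝ} (hK : 0 < K) (x : ℝ) :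
    |(((Finset.Ioc ⌊T₀ * K⌋₊ ⌊T₁ * K⌋₊).filter fun N : ℕ => g (N / K) ≤ x).card : ℝ)
      - K * ((T₁ - T₀) * ramp ((x - (s * T₀ + min 0 (s' * (T₁ - T₀)))) / (|s'| * (T₁ - T₀))))|
      ≤ 1 := by
  have := abs_card_linear_sub_le (v := s * T₀) h.pos.le h.lt hK h.right_ne_zero x
  refine le_of_eq_of_le ?_ this
  congr 4
  refine Finset.filter_congr fun N hN => ?_
  rw [Finset.mem_Ioc, Nat.floor_lt (mul_nonneg h.pos.le hK.le),
    Nat.le_floor_iff (mul_nonneg (h.pos.trans h.lt).le hK.le)] at hN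
  rw [h.right]
  refine ⟨?_, ?_⟩
  · rw [le_div_iff₀ hK]
    exact hN.1.le
  · rw [div_le_iff₀ hK]
    exact hN.2

lemma abs_card_sub_ramp_le (h : FoldsBack g T₀ T₁ s s') {K : ℝ} (hK : 0 < K) (x : ℝ) :
    |(((Finset.Icc 1 ⌊T₀ * K⌋₊).filter fun N : ℕ => g (N / K) ≤ x).card : ℝ)
      - K * (T₀ * ramp ((x - min 0 (s * T₀)) / (|s| * T₀)))| ≤ 2 :=
  (h.abs_card_left_sub_le hK x).trans one_le_two

lemma abs_card_sub_foldCdf_le (h : FoldsBack g T₀ T₁ s s') {K : ℝ} (hK : 0 < K) (x : ℝ) :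
    |(((Finset.Icc 1 ⌊T₁ * K⌋₊).filter fun N : ℕ => g (N / K) ≤ x).card : ℝ)
      - K * (T₁ * foldCdf T₀ T₁ s s' x)| ≤ 2 := by
  have hle : ⌊T₀ * K⌋₊ ≤ ⌊T₁ * K⌋₊ :=
    Nat.floor_le_floor (mul_le_mul_of_nonneg_right h.lt.le hK.le)
  have hunion : Finset.Icc 1 ⌊T₁ * K⌋₊
      = Finset.Ioc 0 ⌊T₀ * K⌋₊ ∪ Finset.Ioc ⌊T₀ * K⌋₊ ⌊T₁ * K⌋₊ := by
    ext N
    simp only [Finset.mem_union, Finset.mem_Icc, Finset.mem_Ioc]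
    omega
  have hdisj : Disjoint (Finset.Ioc 0 ⌊T₀ * K⌋₊) (Finset.Ioc ⌊T₀ * K⌋₊ ⌊T₁ * K⌋₊) :=
    Finset.disjoint_left.2 fun N h1 h2 => by
      rw [Finset.mem_Ioc] at h1 h2
      omega
  rw [hunion, Finset.filter_union, Finset.card_union_of_disjoint (hdisj.mono
    (Finset.filter_subset _ _) (Finset.filter_subset _ _)), foldCdf, twoRamps,
    mul_div_cancel₀ _ (h.pos.trans h.lt).ne', mul_add, Nat.cast_add]
  have h1 := abs_le.1 (h.abs_card_left_sub_le hK x)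
  have h2 := abs_le.1 (h.abs_card_right_sub_le hK x)
  rw [abs_le]
  constructor <;> linarith

end FoldsBack

lemma abs_max_sub_sub_le (t τ τ' : ℝ) : |max 0 (t - τ) - max 0 (t - τ')| ≤ |τ - τ'| := by
  refine (abs_max_sub_max_le_max _ _ _ _).trans ?_
  rw [sub_self, abs_zero, sub_sub_sub_cancel_left, abs_sub_comm]
  exact max_le (abs_nonneg _) le_rfl

lemma abs_shape_sub_shape_le {t : ℝ} (ht : t ∈ Icc (0 : ℝ) 1) (τ σ τ' σ' : ℝ) :
    |shape τ σ t - shape τ' σ' t| ≤ 2 * |τ - τ'| + 2 * |σ - σ'| := by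
  have h1 := abs_le.1 (abs_max_sub_sub_le t τ τ')
  have h2 := abs_le.1 (abs_max_sub_sub_le t σ σ')
  have h3 := abs_le.1 ((abs_mul (τ - τ') t).trans_le
    (mul_le_of_le_one_right (abs_nonneg _) ((abs_of_nonneg ht.1).trans_le ht.2)))
  have h4 := abs_le.1 ((abs_mul (σ - σ') t).trans_le
    (mul_le_of_le_one_right (abs_nonneg _) ((abs_of_nonneg ht.1).trans_le ht.2)))
  unfold shape
  rw [abs_le]
  constructor <;> linarith

/-- All laws obtained along the times `T * K n` have the same type as a given limit law. -/
lemma exists_affine_of_empirical {S : ℕ → ℝ} {K a c r η : ℕ → ℝ} {g : ℝ → ℝ}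
    (hK : Tendsto K atTop atTop) (hK0 : ∀ n, 0 < K n) (ha : ∀ n, 0 < a n)
    (hr : Tendsto r atTop (𝓝 0)) (hη : Tendsto η atTop (𝓝 0))
    (hbad : ∀ n, (((Finset.Icc 1 ⌊K n⌋₊).filter fun N : ℕ =>
      r n < |(S N - c n) / a n - g (N / K n)|).card : ℝ) ≤ K n * η n)
    {A B : ℕ → ℝ} (hB : ∀ M, 0 < B M) {H : ℝ → ℝ} {y₁ y₂ : ℝ} (hy : y₁ < y₂)
    (h₁ : H y₁ ∈ Ioo (0 : ℝ) 1) (h₂ : H y₂ ∈ Ioo (0 : ℝ) 1) (htop : Tendsto H atTop (𝓝 1))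
    (hlim : ∀ y, Tendsto (fun M : ℕ => (((Finset.Icc 1 M).filter fun N : ℕ =>
      (S N - A M) / B M ≤ y).card : ℝ) / M) atTop (𝓝 (H y)))
    {T : ℝ} {Φ : ℝ → ℝ} (hT : 0 < T) (hT1 : T ≤ 1) (hΦ : Continuous Φ)
    (hstrict : ∀ x y, x < y → 0 < Φ y → Φ x < 1 → Φ x < Φ y)
    {u v : ℝ} (hu : Φ u = 0) (hv : Φ v = 1)
    (hcount : ∀ n x, |(((Finset.Icc 1 ⌊T * K n⌋₊).filter fun N : ℕ => g (N / K n) ≤ x).card : ℝ)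
      - K n * (T * Φ x)| ≤ 2) :
    ∃ α β : ℝ, 0 < β ∧ ∀ y, H y = Φ (α + β * y) := by
  have hM : Tendsto (fun n => ⌊T * K n⌋₊) atTop atTop :=
    tendsto_nat_floor_atTop.comp (hK.const_mul_atTop hT)
  refine exists_affine_of_tendsto
    (f := fun n x => (((Finset.Icc 1 ⌊T * K n⌋₊).filter fun N : ℕ =>
      (S N - c n) / a n ≤ x).card : ℝ) / ⌊T * K n⌋₊)
    (A := fun n => (A ⌊T * K n⌋₊ - c n) / a n) (B := fun n => B ⌊T * K n⌋₊ / a n)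
    (fun n x y hxy => ?_) (tendsto_empirical hT hT1 hK hK0 hr hη hbad hΦ hcount)
    hΦ hstrict hu hv (fun n => div_pos (hB _) (ha n)) (fun y => ?_) hy h₁ h₂ htop
  · dsimp only
    gcongr
  · refine ((hlim y).comp hM).congr fun n => ?_
    simp only [Function.comp]
    congr 3
    refine Finset.filter_congr fun N _ => ?_
    have ha' := ha n
    rw [div_mul_eq_mul_div, ← add_div, div_le_div_iff_of_pos_right ha', div_le_iff₀ (hB _)]
    constructor <;> intro h <;> linarith

theorem false_of_forall_hasProfile {S : ℕ → ℝ} {δ : ℝ} (hδ : 0 < δ)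
    (hS : ∀ n, 0 < n → HasProfile S δ n)
    {A B : ℕ → ℝ} (hB : ∀ M, 0 < B M) {H : ℝ → ℝ} {y₁ y₂ : ℝ} (hy : y₁ < y₂)
    (h₁ : H y₁ ∈ Ioo (0 : ℝ) 1) (h₂ : H y₂ ∈ Ioo (0 : ℝ) 1) (htop : Tendsto H atTop (𝓝 1))
    (hlim : ∀ y, Tendsto (fun M : ℕ => (((Finset.Icc 1 M).filter fun N : ℕ =>
      (S N - A M) / B M ≤ y).card : ℝ) / M) atTop (𝓝 (H y))) : False := by
  choose K a c τ σ hK ha hτ hσ hd hd' hbad using fun n : ℕ => hS (n + 1) n.succ_pos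
  obtain ⟨⟨τ₀, σ₀⟩, ⟨hτ₀, hσ₀⟩, φ, hφ, hlimφ⟩ :=
    (isCompact_Icc.prod isCompact_Icc).tendsto_subseq (x := fun n => (τ n, σ n))
      fun n => ⟨hτ n, hσ n⟩
  have hτlim : Tendsto (fun n => τ (φ n)) atTop (𝓝 τ₀) := (continuous_fst.tendsto _).comp hlimφ
  have hσlim : Tendsto (fun n => σ (φ n)) atTop (𝓝 σ₀) := (continuous_snd.tendsto _).comp hlimφ
  have hdlim := (hτlim.sub hσlim).abs
  have hlow : δ ≤ |τ₀ - σ₀| := ge_of_tendsto' hdlim fun n => hd _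
  have hup : |τ₀ - σ₀| ≤ 1 - δ := le_of_tendsto' hdlim fun n => hd' _
  obtain ⟨T₀, T₁, s, s', hg⟩ := exists_foldsBack_shape hτ₀ hσ₀ (by linarith) (by linarith)
  have hKn : ∀ n : ℕ, (n : ℝ) + 1 ≤ K n := fun n => by exact_mod_cast hK n
  have hK0 : ∀ n, 0 < K n := fun n => lt_of_lt_of_le (by positivity) (hKn n)
  have ha0 : ∀ n, 0 < a n := fun n =>
    lt_of_lt_of_le (by positivity : (0 : ℝ) < ((n + 1 : ℕ) : ℝ)) (ha n)
  have hKlim : Tendsto (fun n => K (φ n)) atTop atTop :=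
    (tendsto_atTop_mono (fun n => (le_add_of_nonneg_right zero_le_one).trans (hKn n))
      tendsto_natCast_atTop_atTop).comp hφ.tendsto_atTop
  have hinv : Tendsto (fun n => 1 / ((φ n : ℝ) + 1)) atTop (𝓝 0) :=
    tendsto_one_div_add_atTop_nhds_zero_nat.comp hφ.tendsto_atTop
  have hr : Tendsto (fun n => 1 / ((φ n : ℝ) + 1) + (2 * |τ (φ n) - τ₀| + 2 * |σ (φ n) - σ₀|))
      atTop (𝓝 0) := by
    have h1 := ((hτlim.sub_const τ₀).abs.const_mul 2).add ((hσlim.sub_const σ₀).abs.const_mul 2)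
    simpa using hinv.add h1
  have hbad' : ∀ n, (((Finset.Icc 1 ⌊K (φ n)⌋₊).filter fun N : ℕ =>
      1 / ((φ n : ℝ) + 1) + (2 * |τ (φ n) - τ₀| + 2 * |σ (φ n) - σ₀|)
        < |(S N - c (φ n)) / a (φ n) - shape τ₀ σ₀ (N / K (φ n))|).card : ℝ)
      ≤ K (φ n) * (1 / ((φ n : ℝ) + 1)) := by
    intro n
    refine le_trans ?_ ((hbad (φ n)).trans_eq (by push_cast; ring))
    refine Nat.cast_le.2 (Finset.card_le_card fun N hN => ?_)
    rw [Finset.mem_filter] at hN ⊢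
    refine ⟨hN.1, ?_⟩
    have hNK : (N : ℝ) ≤ K (φ n) :=
      (Nat.cast_le.2 (Finset.mem_Icc.1 hN.1).2).trans (Nat.floor_le (hK0 _).le)
    have ht : (N : ℝ) / K (φ n) ∈ Icc (0 : ℝ) 1 :=
      ⟨div_nonneg (Nat.cast_nonneg _) (hK0 _).le, div_le_one_of_le₀ hNK (hK0 _).le⟩
    have h1 := abs_shape_sub_shape_le ht (τ (φ n)) (σ (φ n)) τ₀ σ₀
    have h2 := abs_sub_le ((S N - c (φ n)) / a (φ n))
      (shape (τ (φ n)) (σ (φ n)) (N / K (φ n))) (shape τ₀ σ₀ (N / K (φ n)))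
    have h3 : 1 / ((φ n : ℝ) + 1) <
        |(S N - c (φ n)) / a (φ n) - shape (τ (φ n)) (σ (φ n)) (N / K (φ n))| := by
      linarith [hN.2]
    have h4 : S N - c (φ n) - a (φ n) * shape (τ (φ n)) (σ (φ n)) (N / K (φ n))
        = a (φ n) *
          ((S N - c (φ n)) / a (φ n) - shape (τ (φ n)) (σ (φ n)) (N / K (φ n))) := by
      have := (ha0 (φ n)).ne'
      field_simp
    rw [h4, abs_mul, abs_of_pos (ha0 _), div_eq_mul_one_div]
    push_cast
    exact mul_lt_mul_of_pos_left h3 (ha0 _)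
  have hh₀ : 0 < |s| * T₀ := mul_pos (abs_pos.2 hg.left_ne_zero) hg.pos
  have hh₁ : 0 < |s'| * (T₁ - T₀) := mul_pos (abs_pos.2 hg.right_ne_zero) (sub_pos.2 hg.lt)
  obtain ⟨hm, hm'⟩ := hg.nested
  have hT₁ := hg.pos.trans hg.lt
  obtain ⟨α₀, β₀, -, e₀⟩ := exists_affine_of_empirical hKlim (fun n => hK0 _) (fun n => ha0 (φ n))
    hr hinv hbad' hB hy h₁ h₂ htop hlim
    (Φ := fun x => ramp ((x - min 0 (s * T₀)) / (|s| * T₀)))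
    hg.pos (hg.lt.le.trans hg.le_one) (continuous_ramp.comp (by fun_prop))
    (fun x y hxy hy hx => ramp_lt_ramp (by gcongr) (ramp_pos_iff.1 hy) (ramp_lt_one_iff.1 hx))
    (u := min 0 (s * T₀)) (ramp_of_nonpos (by simp))
    (v := min 0 (s * T₀) + |s| * T₀) (ramp_of_one_le (by rw [add_sub_cancel_left, div_self hh₀.ne']))
    (fun n => hg.abs_card_sub_ramp_le (hK0 _))
  obtain ⟨α₁, β₁, hβ₁, e₁⟩ := exists_affine_of_empirical hKlim (fun n => hK0 _)
    (fun n => ha0 (φ n)) hr hinv hbad' hB hy h₁ h₂ htop hlim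
    (Φ := foldCdf T₀ T₁ s s') hT₁ hg.le_one continuous_twoRamps
    (twoRamps_strict hg.pos hg.lt.le hh₀ hh₁ hm hm')
    (twoRamps_eq_zero hh₁ hm) (twoRamps_eq_one hT₁ hh₀ hh₁ hm')
    (fun n => hg.abs_card_sub_foldCdf_le (hK0 _))
  refine false_of_twoRamps_eq_ramp hg.pos hg.lt hh₀ hh₁ hm hm' hg.short
    (a := (α₀ - β₀ * α₁ / β₁ - min 0 (s * T₀)) / (|s| * T₀)) (b := β₀ / β₁ / (|s| * T₀))
    fun x => ?_
  have h1 := e₁ ((x - α₁) / β₁)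
  rw [mul_div_cancel₀ _ hβ₁.ne', add_sub_cancel, e₀] at h1
  rw [foldCdf] at h1
  rw [← h1]
  congr 1
  field_simp
  ring

lemma exists_two_points_cdf {Ω : Type*} [MeasurableSpace Ω] {P : Measure Ω}
    [IsProbabilityMeasure P] {Y : Ω → ℝ} (hY : Measurable Y) (hne : ¬ ∃ c : ℝ, ∀ᵐ ω ∂P, Y ω = c) :
    (∃ y₁ y₂ : ℝ, y₁ < y₂ ∧ (P {ω | Y ω ≤ y₁}).toReal ∈ Ioo (0 : ℝ) 1 ∧
      (P {ω | Y ω ≤ y₂}).toReal ∈ Ioo (0 : ℝ) 1) ∧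
    Tendsto (fun y => (P {ω | Y ω ≤ y}).toReal) atTop (𝓝 1) := by
  have : IsProbabilityMeasure (P.map Y) := Measure.isProbabilityMeasure_map hY.aemeasurable
  have hcdf : (fun y => (P {ω | Y ω ≤ y}).toReal) = ProbabilityTheory.cdf (P.map Y) := by
    funext y
    rw [ProbabilityTheory.cdf_eq_real, measureReal_def, Measure.map_apply hY measurableSet_Iic]
    rfl
  refine ⟨?_, hcdf ▸ ProbabilityTheory.tendsto_cdf_atTop _⟩
  obtain ⟨y, hy⟩ : ∃ y, (P {ω | Y ω ≤ y}).toReal ∈ Ioo (0 : ℝ) 1 := by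
    by_contra! hcon
    refine hne (exists_eventuallyEq_const_of_forall_separating (l := ae P) (f := Y)
      (· ∈ range (Iic : ℝ → Set ℝ)) ?_)
    rintro _ ⟨y, rfl⟩
    have hmeas : MeasurableSet {ω | Y ω ≤ y} := hY measurableSet_Iic
    by_cases h0 : P {ω | Y ω ≤ y} = 0
    · exact Or.inr (measure_eq_zero_iff_ae_notMem.1 h0)
    · refine Or.inl ((prob_compl_eq_zero_iff hmeas).2 ?_)
      by_contra h1
      refine hcon y ⟨ENNReal.toReal_pos h0 (measure_ne_top _ _), ?_⟩
      rw [← ENNReal.toReal_one]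
      exact (ENNReal.toReal_lt_toReal (measure_ne_top _ _) ENNReal.one_ne_top).2
        (lt_of_le_of_ne prob_le_one h1)
  have hev : ∀ᶠ z in 𝓝[>] y, ProbabilityTheory.cdf (P.map Y) z < 1 := by
    refine (((ProbabilityTheory.cdf (P.map Y)).right_continuous y).mono_left
      (nhdsWithin_mono _ Ioi_subset_Ici_self)).eventually (gt_mem_nhds ?_)
    rw [← hcdf]
    exact hy.2
  obtain ⟨z, hz, hyz⟩ := (hev.and self_mem_nhdsWithin).exists
  refine ⟨y, z, hyz, hy, ?_, ?_⟩
  · exact hy.1.trans_le (ENNReal.toReal_mono (measure_ne_top _ _)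
      (measure_mono fun ω hω => le_trans hω (le_of_lt hyz)))
  · rw [← hcdf] at hz
    exact hz

lemma iota_coe_of_mem {a : ℝ} (ha : a ∈ Ioo (0 : ℝ) 1) : iota (a : UnitAddCircle) = a := by
  rw [iota, AddCircle.coe_equivIco_mk_apply]
  simpa using Int.fract_eq_self.2 ⟨ha.1.le, ha.2⟩

lemma coe_iota (x : UnitAddCircle) : ((iota x : ℝ) : UnitAddCircle) = x :=
  AddCircle.coe_equivIco

lemma measurable_iota : Measurable iota :=
  measurable_subtype_coe.comp (AddCircle.measurableEquivIco (1 : ℝ) 0).measurable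

lemma ae_iota_mem {E : Set ℝ} (hE : MeasurableSet E)
    (h : ∀ᵐ a ∂(volume.restrict (Ioo (0 : ℝ) 1)), a ∈ E) :
    ∀ᵐ α ∂(volume : Measure UnitAddCircle), iota α ∈ E := by
  have hmp := UnitAddCircle.measurePreserving_mk 0
  rw [← hmp.map_eq, ae_map_iff hmp.measurable.aemeasurable (measurable_iota hE), zero_add,
    ← restrict_Ioo_eq_restrict_Ioc]
  filter_upwards [h, ae_restrict_mem measurableSet_Ioo] with a ha ha'
  exact (iota_coe_of_mem ha').symm ▸ ha

lemma birkhoff_centered_indicator (β α x₀ : UnitAddCircle) (N : ℕ) :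
    birkhoff (fun x => (if iota x < iota β then (1 : ℝ) else 0) - iota β) α x₀ N
      = floorSum (iota β) (iota x₀) (iota α) N := by
  have h := birkhoff_indicator_eq β (iota x₀) (iota α) N
  rw [coe_iota, coe_iota] at h
  exact h

end NoTDLT

/-- For the centered indicator `f(x) = 𝟙_{[0,β)}(x) - ι(β)` with `β ≠ 0`, for a.e. `α`
and every `x₀`, no temporal distributional limit theorem holds for `S_N(f, α, x₀)`. -/
theorem no_TDLT_indicator (β : UnitAddCircle) (hβ : β ≠ 0) :
    ∀ᵐ α ∂(volume : Measure UnitAddCircle), ∀ x₀ : UnitAddCircle,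
      ¬ SatisfiesTDLT (fun x => (if iota x < iota β then (1 : ℝ) else 0) - iota β) α x₀ := by
  obtain ⟨δ, hδ, hδβ⟩ := NoTDLT.exists_norm_nsmul_ge hβ
  have hgood : ∀ᵐ a ∂(volume.restrict (Ioo (0 : ℝ) 1)),
      a ∈ {a : ℝ | Irrational a} ∩ ⋂ n : ℕ,
        NoTDLT.goodApprox β δ (1 / (8 * ((n + 1 : ℕ) : ℝ) ^ 3)) (n + 1) := by
    have h1 : ∀ᵐ a ∂(volume : Measure ℝ), Irrational a := by
      have := (countable_range ((↑) : ℚ → ℝ)).ae_notMem (volume : Measure ℝ)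
      exact this
    have h2 := ae_all_iff.2 fun n : ℕ => NoTDLT.ae_mem_goodApprox hδβ
      (by positivity : 0 < 1 / (8 * ((n + 1 : ℕ) : ℝ) ^ 3)) (n + 1)
    filter_upwards [ae_restrict_of_ae h1, h2] with a ha ha'
    exact ⟨ha, mem_iInter.2 ha'⟩
  have hmeas : MeasurableSet ({a : ℝ | Irrational a} ∩ ⋂ n : ℕ,
      NoTDLT.goodApprox β δ (1 / (8 * ((n + 1 : ℕ) : ℝ) ^ 3)) (n + 1)) :=
    ((countable_range ((↑) : ℚ → ℝ)).measurableSet.compl).inter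
      (MeasurableSet.iInter fun n => (NoTDLT.isOpen_goodApprox _ _ _ _).measurableSet)
  filter_upwards [NoTDLT.ae_iota_mem hmeas hgood] with α hα x₀
  rintro ⟨A, B, Ω, _, P, Y, hB, -, _, hY, hne, hlim⟩
  obtain ⟨⟨y₁, y₂, hy, h₁, h₂⟩, htop⟩ := NoTDLT.exists_two_points_cdf hY hne
  refine NoTDLT.false_of_forall_hasProfile (S := NoTDLT.floorSum (iota β) (iota x₀) (iota α))
    (A := A) hδ (fun n hn => ?_) hB hy h₁ h₂ htop fun y => ?_
  · obtain ⟨n, rfl⟩ := Nat.exists_eq_succ_of_ne_zero hn.ne'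
    refine NoTDLT.hasProfile_of_mem_goodApprox n.succ_pos hα.1 ?_ _
    rw [NoTDLT.coe_iota]
    exact mem_iInter.1 hα.2 n
  · refine (hlim y).congr fun M => ?_
    simp only [NoTDLT.birkhoff_centered_indicator]
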